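/- If Λ is a lattice in ℝ⁹ possessing a Minkowskian sublattice Λ' with Λ/Λ' cyclic of order d, then d ∈ {1, 2, 3, 4, 5, 6, 7, 8, 9, 10, 12}; in particular no 9-dimensional lattice admits a Minkowskian sublattice with cyclic quotient of order 11 or of any order d ≥ 13. -/

import Mathlib

open scoped BigOperators RealInnerProductSpace

noncomputable section

/-- The minimum of a lattice `Λ` in `ℝⁿ`: the infimum of the squared Euclidean
lengths `N(x) = ⟪x, x⟫` of the nonzero vectors of `Λ`. -/
def latticeMin {n : ℕ} (Λ : Submodule ℤ (EuclideanSpace ℝ (Fin n))) : ℝ :=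
  sInf {r : ℝ | ∃ x ∈ Λ, x ≠ 0 ∧ ⟪x, x⟫ = r}

/-- The set of minimal vectors of a lattice `Λ`:
`S(Λ) = {x ∈ Λ : x ≠ 0, N(x) = min Λ}`. -/
def minimalVectors {n : ℕ} (Λ : Submodule ℤ (EuclideanSpace ℝ (Fin n))) :
    Set (EuclideanSpace ℝ (Fin n)) :=
  {x | x ∈ Λ ∧ x ≠ 0 ∧ ⟪x, x⟫ = latticeMin Λ}

/-- `Λ` is a (full-rank) lattice in `ℝⁿ`: a discrete subgroup that spans `ℝⁿ`. -/
def IsLattice {n : ℕ} (Λ : Submodule ℤ (EuclideanSpace ℝ (Fin n))) : Prop :=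
  DiscreteTopology Λ ∧ Submodule.span ℝ (Λ : Set (EuclideanSpace ℝ (Fin n))) = ⊤

/-- `Λ'` is a Minkowskian sublattice of `Λ`: it is generated by `n` linearly
independent minimal vectors of `Λ`. -/
def IsMinkowskian {n : ℕ} (Λ Λ' : Submodule ℤ (EuclideanSpace ℝ (Fin n))) : Prop :=
  ∃ e : Fin n → EuclideanSpace ℝ (Fin n),
    LinearIndependent ℝ e ∧ (∀ i, e i ∈ minimalVectors Λ) ∧
      Λ' = Submodule.span ℤ (Set.range e)

/-- The quotient group `Λ/Λ'`. -/
abbrev quotLat {n : ℕ} (Λ Λ' : Submodule ℤ (EuclideanSpace ℝ (Fin n))) : Type :=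
  Λ ⧸ (Submodule.comap Λ.subtype Λ')

/-- The index `[Λ : Λ']`. -/
def subIndex {n : ℕ} (Λ Λ' : Submodule ℤ (EuclideanSpace ℝ (Fin n))) : ℕ :=
  Nat.card (quotLat Λ Λ')

namespace Minkowskian

/-- `Realizable d a` says that there is a lattice of minimum `1` in dimension `9` generated by a
basis of minimal vectors `e i` (with Gram matrix `G`) together with `(∑ i, a i • e i) / d`, the
quotient being cyclic of order `d`. -/
def Realizable (d : ℕ) (a : Fin 9 → ℤ) : Prop :=
  (∀ k : ℤ, (∀ i, (d : ℤ) ∣ k * a i) → (d : ℤ) ∣ k) ∧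
  ∃ G : Fin 9 → Fin 9 → ℝ, (∀ i j, G i j = G j i) ∧ (∀ i, G i i = 1) ∧
    ∀ v : Fin 9 → ℤ, v ≠ 0 → (∃ k : ℤ, ∀ i, (d : ℤ) ∣ v i - k * a i) →
      (d : ℝ) ^ 2 ≤ ∑ i, ∑ j, v i * v j * G i j

/-- Realizability is preserved by permutations, sign changes, multiplication by units and reduction
to a divisor of `d`. -/
theorem Realizable.transfer {q m : ℕ} (hq : 0 < q) {a b : Fin 9 → ℤ}
    (h : Realizable (q * m) a) (σ : Equiv.Perm (Fin 9)) {u : ℤ} (hu : IsCoprime (m : ℤ) u)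
    {ε : Fin 9 → ℤ} (hε : ∀ i, ε i * ε i = 1) (hb : ∀ i, (m : ℤ) ∣ b i - ε i * (u * a (σ i))) :
    Realizable m b := by
  obtain ⟨h1, G, hs, hd, hG⟩ := h
  have hq' : (q : ℤ) ≠ 0 := by exact_mod_cast hq.ne'
  refine ⟨fun k hk => ?_, fun i j => ε i * ε j * G (σ i) (σ j), fun i j => ?_, fun i => ?_,
    fun v hv hk => ?_⟩
  · have h2 : ((q * m : ℕ) : ℤ) ∣ q * (k * u) := by
      apply h1
      intro j
      obtain ⟨i, rfl⟩ := σ.surjective j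
      have h3 : (m : ℤ) ∣ k * u * a (σ i) := by
        have := ((hk i).sub ((hb i).mul_left k)).mul_left (ε i)
        have e : ε i * (k * b i - k * (b i - ε i * (u * a (σ i)))) =
          ε i * ε i * (k * u * a (σ i)) := by ring
        rwa [e, hε, one_mul] at this
      push_cast
      rw [mul_assoc (q : ℤ)]
      exact mul_dvd_mul_left _ h3
    push_cast at h2
    exact hu.dvd_of_dvd_mul_right (Int.dvd_of_mul_dvd_mul_left hq' h2)
  · simp only [hs (σ i)]; ring
  · have : (ε i : ℝ) * ε i = 1 := by exact_mod_cast hε i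
    simp [hd, this]
  · obtain ⟨k, hk⟩ := hk
    have key := hG (fun j => q * (ε (σ.symm j) * v (σ.symm j))) ?_ ⟨q * (k * u), fun j => ?_⟩
    · rw [← Equiv.sum_comp σ] at key
      simp_rw [← Equiv.sum_comp σ (fun j => (_ : ℝ) * _ * G _ j)] at key
      simp only [Equiv.symm_apply_apply] at key
      have hq2 : (0 : ℝ) < (q : ℝ) ^ 2 := by positivity
      refine le_of_mul_le_mul_left ?_ hq2
      calc (q : ℝ) ^ 2 * (m : ℝ) ^ 2 = ((q * m : ℕ) : ℝ) ^ 2 := by push_cast; ring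
        _ ≤ _ := key
        _ = _ := by
          simp only [Finset.mul_sum]
          refine Finset.sum_congr rfl fun i _ => Finset.sum_congr rfl fun j _ => ?_
          push_cast
          ring
    · intro h0
      apply hv
      funext i
      have h4 := congrFun h0 (σ i)
      simp only [Equiv.symm_apply_apply, Pi.zero_apply, mul_eq_zero, hq', false_or] at h4
      rcases h4 with h4 | h4
      · have := hε i
        rw [h4] at this
        simp at this
      · exact h4
    · obtain ⟨i, rfl⟩ := σ.surjective j
      simp only [Equiv.symm_apply_apply]
      have h3 : (m : ℤ) ∣ ε i * v i - k * u * a (σ i) := by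
        have := ((hk i).add ((hb i).mul_left k)).mul_left (ε i)
        have e : ε i * (v i - k * b i + k * (b i - ε i * (u * a (σ i)))) =
          ε i * v i - ε i * ε i * (k * u * a (σ i)) := by ring
        rwa [e, hε, one_mul] at this
      push_cast
      rw [mul_assoc, ← mul_sub]
      exact mul_dvd_mul_left _ h3

theorem sum_sum_single_add {G : Fin 9 → Fin 9 → ℝ} (hs : ∀ i j, G i j = G j i)
    (v : Fin 9 → ℝ) (c : ℝ) (i : Fin 9) :
    ∑ p, ∑ q, (v p + c * if p = i then 1 else 0) * (v q + c * if q = i then 1 else 0) * G p q =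
      ∑ p, ∑ q, v p * v q * G p q + 2 * c * ∑ q, v q * G i q + c ^ 2 * G i i := by
  have e : ∀ p q, (v p + c * if p = i then 1 else 0) * (v q + c * if q = i then 1 else 0) * G p q =
      v p * v q * G p q + (if q = i then c * (v p * G p q) else 0) +
      (if p = i then c * (v q * G p q) else 0) +
      (if p = i then if q = i then c ^ 2 * G p q else 0 else 0) := by
    intro p q
    split_ifs <;> ring
  simp_rw [e, Finset.sum_add_distrib]
  have e2 : ∀ p, (∑ q, if p = i then c * (v q * G p q) else 0) =
    if p = i then ∑ q, c * (v q * G p q) else 0 := by intro p; split_ifs <;> simp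
  have e3 : ∀ p, (∑ q, if p = i then (if q = i then c ^ 2 * G p q else 0) else 0) =
    if p = i then ∑ q, (if q = i then c ^ 2 * G p q else 0) else 0 := by
      intro p; split_ifs <;> simp
  simp_rw [e2, e3]
  simp only [Finset.sum_ite_eq', Finset.mem_univ, if_true]
  simp_rw [fun p => hs p i, ← Finset.mul_sum]
  ring

/-- Watson's condition. -/
theorem Realizable.watson {d : ℕ} (hd : 0 < d) {a : Fin 9 → ℤ} (h : Realizable d a) {k : ℤ}
    (hk : ¬ (d : ℤ) ∣ k) (v : Fin 9 → ℤ) (hv : ∀ i, (d : ℤ) ∣ v i - k * a i) :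
    2 * (d : ℤ) ≤ ∑ i, |v i| := by
  obtain ⟨h1, G, hs, hdiag, hG⟩ := h
  have hne : ∀ w : Fin 9 → ℤ, (∀ i, (d : ℤ) ∣ w i - k * a i) → w ≠ 0 := by
    rintro w hw rfl
    exact hk (h1 k fun i => by simpa using hw i)
  have hdR : (0 : ℝ) < d := by exact_mod_cast hd
  by_contra! hlt
  have hltR : (∑ i, |(v i : ℝ)|) < 2 * d := by exact_mod_cast hlt
  set N := ∑ i, ∑ j, (v i : ℝ) * v j * G i j with hN
  have hNd : (d : ℝ) ^ 2 ≤ N := hG v (hne v hv) ⟨k, hv⟩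
  have key : ∀ i, |(v i : ℝ)| * (d : ℝ) ^ 2 ≤
      |(v i : ℝ)| * (N + d ^ 2) - 2 * d * (v i * ∑ q, v q * G i q) := by
    intro i
    have hw : ∀ p, (d : ℤ) ∣ (v p + -(d * (v i).sign) * if p = i then 1 else 0) - k * a p := by
      intro p
      have := (hv p).sub (Dvd.intro ((v i).sign * if p = i then 1 else 0) rfl)
      have e : v p - k * a p - d * ((v i).sign * if p = i then 1 else 0) =
        v p + -(d * (v i).sign) * (if p = i then 1 else 0) - k * a p := by ring
      rwa [e] at this
    have h2 := hG _ (hne _ hw) ⟨k, hw⟩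
    push_cast at h2
    rw [sum_sum_single_add hs, hdiag, ← hN] at h2
    have hsg : |(v i : ℝ)| * ((v i).sign : ℝ) = v i := by
      rw [mul_comm]; exact_mod_cast Int.sign_mul_abs (v i)
    by_cases h0 : v i = 0
    · simp [h0]
    have hsq : ((v i).sign : ℝ) ^ 2 = 1 := by
      rcases lt_or_gt_of_ne h0 with h0 | h0
      · rw [Int.sign_eq_neg_one_of_neg h0]; norm_num
      · rw [Int.sign_eq_one_of_pos h0]; norm_num
    have h3 := mul_le_mul_of_nonneg_left h2 (abs_nonneg (v i : ℝ))
    calc _ ≤ _ := h3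
      _ = |(v i : ℝ)| * (N + d ^ 2 * ((v i).sign : ℝ) ^ 2) -
          2 * d * ((|(v i : ℝ)| * ((v i).sign : ℝ)) * ∑ q, v q * G i q) := by ring
      _ = _ := by rw [hsg, hsq, mul_one]
  have hsum := Finset.sum_le_sum fun i (_ : i ∈ Finset.univ) => key i
  rw [Finset.sum_sub_distrib, ← Finset.sum_mul, ← Finset.sum_mul, ← Finset.mul_sum] at hsum
  have hN' : ∑ i, (v i : ℝ) * ∑ q, v q * G i q = N := by
    rw [hN]
    refine Finset.sum_congr rfl fun i _ => ?_
    rw [Finset.mul_sum]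
    exact Finset.sum_congr rfl fun j _ => by ring
  rw [hN'] at hsum
  have : 0 < N := lt_of_lt_of_le (by positivity) hNd
  nlinarith

/-- The inner product of two independent minimal vectors is at most half the minimum. -/
theorem abs_le_half_of_minimal {d : ℕ} (hd : 0 < d) {a : Fin 9 → ℤ} {G : Fin 9 → Fin 9 → ℝ}
    (hs : ∀ i j, G i j = G j i) (hdiag : ∀ i, G i i = 1)
    (hG : ∀ v : Fin 9 → ℤ, v ≠ 0 → (∃ k : ℤ, ∀ i, (d : ℤ) ∣ v i - k * a i) →
      (d : ℝ) ^ 2 ≤ ∑ i, ∑ j, v i * v j * G i j) {i j : Fin 9} (hij : i ≠ j) :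
    |G i j| ≤ 1 / 2 := by
  have hdR : (0 : ℝ) < d := by exact_mod_cast hd
  have key : ∀ s : ℤ, s ^ 2 = 1 → 0 ≤ 1 + 2 * (s : ℝ) * G i j := by
    intro s hs1
    have hsR : (s : ℝ) ^ 2 = 1 := by exact_mod_cast hs1
    have h2 := hG (fun p => (0 + d * if p = i then 1 else 0) + d * s * if p = j then 1 else 0) ?_
      ⟨0, fun p => ?_⟩
    · push_cast at h2
      rw [sum_sum_single_add hs, sum_sum_single_add hs] at h2
      simp only [zero_mul, Finset.sum_const_zero, mul_zero, zero_add, hdiag, mul_ite, ite_mul,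
        Finset.sum_ite_eq', Finset.mem_univ, if_true, mul_one, hs j i] at h2
      have h3 : 0 ≤ (d : ℝ) ^ 2 * (s ^ 2 + 2 * (s : ℝ) * G i j) := by nlinarith
      rw [hsR] at h3
      exact nonneg_of_mul_nonneg_right h3 (by positivity)
    · intro h0
      have := congrFun h0 i
      simp [hij, hd.ne'] at this
    · simp only [zero_mul, sub_zero, zero_add, mul_assoc, ← mul_add]
      exact Dvd.intro _ rfl
  have h1 := key 1 (by norm_num)
  have h2 := key (-1) (by norm_num)
  push_cast at h1 h2
  rw [abs_le]
  constructor <;> linarith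

/-- The distance from `x` to the nearest multiple of `d`. -/
def lee (d x : ℕ) : ℕ := x % d - (2 * (x % d) - d)

/-- The number with base `1024` digits `f 0, …, f (n - 1)`. -/
def pack (f : ℕ → ℕ) : ℕ → ℕ
  | 0 => 0
  | n + 1 => 1024 * pack f n + f n

/-- `force n f = f n`; evaluating the left-hand side in the kernel evaluates `n` first. -/
def force {α : Type} (n : ℕ) (f : ℕ → α) : α :=
  Nat.rec (f 0) (fun m _ => f (Nat.succ m)) n

/-- `forceMap f l k = k (l.map f)`, evaluating the entries of the list first. -/
def forceMap {α β γ : Type} (fc : β → (β → γ) → γ) (f : α → β) :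
    List α → (List β → γ) → γ
  | [], k => k []
  | a :: l, k => fc (f a) fun b => forceMap fc f l fun t => k (b :: t)

/-- The coordinate of the vector described by the certificate item `t`. -/
def coord (d x i t : ℕ) : ℕ :=
  Nat.add (Nat.mod (Nat.mul (Nat.mod (Nat.div t 512) 64) x) d)
   (Nat.mul d (Nat.sub 1 (Nat.mod (Nat.div t (Nat.pow 2 i)) 2)))

/-- The dot product of two lists. -/
def dot (xs : List ℕ) : List ℕ → ℕ :=
  List.rec (fun _ => 0) (fun x _ ih ys =>
    List.rec 0 (fun y ys _ => Nat.add (Nat.mul x y) (ih ys)) ys) xs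

/-- Passes to the continuation the columns, together with their weighted sums, of the matrix whose
rows are the vectors described by the certificate `items` with weights `ws`. -/
def columns (d : ℕ) (items ws : List ℕ) (γ : Type) :
    ℕ → List ℕ → (List (ℕ × List ℕ) → γ) → γ
  | _, [], k => k []
  | i, x :: xs, k => forceMap force (coord d x i) items fun c =>
      force (Nat.mul d (dot ws c)) fun s =>
      columns d items ws γ (i + 1) xs fun cs => k ((s, c) :: cs)

/-- The distance between two natural numbers. -/
def absDiff (x y : ℕ) : ℕ := Nat.add (Nat.sub x y) (Nat.sub y x)

/-- The sum of the absolute values of the entries of one row of the weighted Gram matrix of a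
certificate, to the right of the diagonal and including it. -/
def rowSum (D s : ℕ) (c : List ℕ) : List (ℕ × List ℕ) → ℕ :=
  List.rec 0 (fun y _ ih => Nat.add (force (Nat.add D (dot c y.2)) fun a =>
    force (Nat.add s y.1) fun b => absDiff a b) ih)

/-- The sum of the absolute values of the entries of the weighted Gram matrix of a certificate on and
above the diagonal. -/
def formBound (D : ℕ) (ws : List ℕ) : List (ℕ × List ℕ) → ℕ
  | [] => 0
  | c :: cs => Nat.add (forceMap force id (List.zipWith Nat.mul ws c.2) fun wc =>
     rowSum D c.1 wc (c :: cs)) (formBound D ws cs)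

/-- Whether the certificate `items` shows that `b` is not realizable modulo `d`: the weighted mean of
the norms of the vectors it describes is less than `d ^ 2`. -/
def valid (d : ℕ) (b items : List ℕ) : Bool :=
  (b.length.beq 9 && b.all (fun x => Nat.ble x d) &&
    items.all fun t => Nat.blt 0 (t / 512 % 64) && Nat.blt (t / 512 % 64) d) &&
  forceMap force (fun t => t / 32768) items fun ws =>
   force (d * d * ws.sum) fun D =>
    columns d items ws Bool 0 b fun cs => Nat.blt (formBound D ws cs) D

/-- A list of residues is realizable if it enumerates a realizable vector. -/
def ListRealizable (d : ℕ) (l : List ℕ) : Prop :=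
  ∃ f : Fin 9 → ℕ, l = List.ofFn f ∧ Realizable d (fun i => f i)

theorem exists_perm_of_ofFn_perm {n : ℕ} {f g : Fin n → ℕ}
    (h : (List.ofFn f).Perm (List.ofFn g)) : ∃ σ : Equiv.Perm (Fin n), f = g ∘ σ := by
  have h1 : f ∘ Tuple.sort f = g ∘ Tuple.sort g := by
    apply List.ofFn_injective
    exact (((Tuple.sort f).ofFn_comp_perm f).trans
      (h.trans ((Tuple.sort g).ofFn_comp_perm g).symm)).eq_of_pairwise'
      (Tuple.monotone_sort f).sortedLE_ofFn.pairwise (Tuple.monotone_sort g).sortedLE_ofFn.pairwise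
  refine ⟨(Tuple.sort f).symm.trans (Tuple.sort g), funext fun i => ?_⟩
  have := congrFun h1 ((Tuple.sort f).symm i)
  simpa using this

theorem lee_le (d x : ℕ) (hd : 0 < d) : lee d x ≤ d / 2 := by
  have := Nat.mod_lt x hd
  unfold lee
  omega

theorem exists_sign_lee (d x : ℕ) (hd : 0 < d) :
    ∃ ε : ℤ, ε * ε = 1 ∧ (d : ℤ) ∣ lee d x - ε * x := by
  have h1 := Nat.mod_lt x hd
  have h2 : ((x % d : ℕ) : ℤ) = x - d * ((x / d : ℕ) : ℤ) := by
    have := Nat.mod_add_div x d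
    zify at this
    push_cast
    linarith
  rcases le_total (2 * (x % d)) d with h | h
  · refine ⟨1, by norm_num, ?_⟩
    have : lee d x = x % d := by unfold lee; omega
    rw [this, h2]
    exact ⟨-((x / d : ℕ) : ℤ), by ring⟩
  · refine ⟨-1, by norm_num, ?_⟩
    have : ((lee d x : ℕ) : ℤ) = d - (x % d : ℕ) := by unfold lee; omega
    rw [this, h2]
    exact ⟨1 + ((x / d : ℕ) : ℤ), by ring⟩

theorem ListRealizable.length {d : ℕ} {l : List ℕ} (h : ListRealizable d l) : l.length = 9 := by
  obtain ⟨f, rfl, -⟩ := h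
  simp

theorem ListRealizable.of_perm_map {d m : ℕ} (hd : 0 < d) (hm : m ∣ d) {l l' : List ℕ}
    (h : ListRealizable d l) {u : ℕ} (hu : u.Coprime m)
    (hl : l'.Perm (l.map fun x => lee m (u * x))) : ListRealizable m l' := by
  obtain ⟨f, rfl, hf⟩ := h
  obtain ⟨q, rfl⟩ := hm
  have hm0 : 0 < m := Nat.pos_of_mul_pos_right hd
  have hq : 0 < q := Nat.pos_of_mul_pos_left hd
  rw [mul_comm] at hf
  have hlen : l'.length = 9 := by simpa using hl.length_eq
  obtain ⟨g, rfl⟩ : ∃ g : Fin 9 → ℕ, l' = List.ofFn g :=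
    ⟨l'.get ∘ Fin.cast hlen.symm, (List.ofFn_get l').symm.trans (List.ofFn_congr hlen _)⟩
  rw [List.map_ofFn] at hl
  obtain ⟨σ, rfl⟩ := exists_perm_of_ofFn_perm hl
  refine ⟨_, rfl, ?_⟩
  choose ε hε hε' using fun i => exists_sign_lee m (u * f (σ i)) hm0
  refine hf.transfer hq σ (u := u) ?_ hε fun i => ?_
  · exact (Nat.isCoprime_iff_coprime.mpr hu).symm
  · have := hε' i
    push_cast at this
    exact this

theorem ListRealizable.watson {d : ℕ} (hd : 0 < d) {l : List ℕ} (h : ListRealizable d l) {k : ℕ}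
    (hk : ¬ d ∣ k) : 2 * d ≤ (l.map fun x => lee d (k * x)).sum := by
  obtain ⟨f, rfl, hf⟩ := h
  choose ε hε hε' using fun i => exists_sign_lee d (k * f i) hd
  have hk' : ¬ (d : ℤ) ∣ (k : ℤ) := by exact_mod_cast hk
  have := hf.watson hd hk' (fun i => ε i * lee d (k * f i)) fun i => ?_
  · have h2 : ∀ i, |ε i * (lee d (k * f i) : ℤ)| = lee d (k * f i) := by
      intro i
      have h3 : |ε i| = 1 := by
        rcases mul_self_eq_one_iff.mp (hε i) with h | h <;> simp [h]
      rw [abs_mul, h3, one_mul, Nat.abs_cast]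
    simp only [h2] at this
    rw [List.map_ofFn, List.sum_ofFn]
    exact_mod_cast this
  · have := (hε' i).mul_left (ε i)
    rw [mul_sub, ← mul_assoc, hε, one_mul] at this
    exact_mod_cast this

theorem force_eq {α : Type} (n : ℕ) (f : ℕ → α) : force n f = f n := by
  cases n <;> rfl

theorem forceMap_eq {α β γ : Type} {fc : β → (β → γ) → γ} (hfc : ∀ b k, fc b k = k b)
    (f : α → β) (l : List α) (k : List β → γ) : forceMap fc f l k = k (l.map f) := by
  induction l generalizing k with
  | nil => rfl
  | cons a l ih => simp [forceMap, hfc, ih]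

theorem dot_map {α : Type} (f g : α → ℕ) (l : List α) :
    dot (l.map f) (l.map g) = (l.map fun t => f t * g t).sum := by
  induction l with
  | nil => rfl
  | cons a l ih =>
    rw [List.map_cons (f := fun t => f t * g t), List.sum_cons, ← ih]
    rfl

theorem zipWith_map_mul {α : Type} (f g : α → ℕ) (l : List α) :
    List.zipWith Nat.mul (l.map f) (l.map g) = l.map fun t => f t * g t := by
  induction l with
  | nil => rfl
  | cons a l ih => simp [ih]

theorem columns_eq (d : ℕ) (items ws : List ℕ) (γ : Type) (i : ℕ) (l : List ℕ)
    (k : List (ℕ × List ℕ) → γ) :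
    columns d items ws γ i l k = k ((l.zipIdx i).map fun p =>
      (d * dot ws (items.map (coord d p.1 p.2)), items.map (coord d p.1 p.2))) := by
  induction l generalizing i k with
  | nil => rfl
  | cons a l ih => simp [columns, force_eq, forceMap_eq, ih]

theorem absDiff_eq (x y : ℕ) : (absDiff x y : ℤ) = |(x : ℤ) - y| := by
  change (((x - y) + (y - x) : ℕ) : ℤ) = _
  rcases le_total x y with h | h
  · rw [abs_of_nonpos (by omega)]; omega
  · rw [abs_of_nonneg (by omega)]; omega

theorem coord_bound (d x i t : ℕ) :
    (d : ℤ) ∣ ((coord d x i t : ℕ) - d : ℤ) - ((t / 512 % 64 : ℕ) : ℤ) * x := by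
  have h2 := Nat.mod_add_div (t / 512 % 64 * x) d
  have h3 : coord d x i t = t / 512 % 64 * x % d + d * (1 - t / 2 ^ i % 2) := rfl
  rw [h3]
  generalize 1 - t / 2 ^ i % 2 = e
  generalize t / 512 % 64 = k at *
  zify at h2
  refine ⟨e - 1 - (k * x / d : ℕ), ?_⟩
  push_cast
  linarith

/-- The entry of the weighted Gram matrix of the vectors in a certificate. -/
def weightedEntry {ι : Type} (items : List ℕ) (w : ℕ → ℕ) (v : ι → ℕ → ℤ) (i j : ι) : ℤ :=
  (items.map fun t => w t * v i t * v j t).sum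

theorem weightedEntry_eq {ι : Type} (d : ℕ) (items : List ℕ) (w : ℕ → ℕ) (c : ι → ℕ → ℕ)
    (i j : ι) :
    weightedEntry items w (fun i t => (c i t : ℤ) - d) i j =
      (d * d * (items.map w).sum + dot (items.map fun t => w t * c i t) (items.map (c j)) : ℕ) -
      (d * dot (items.map w) (items.map (c i)) + d * dot (items.map w) (items.map (c j)) : ℕ) := by
  simp only [dot_map, weightedEntry]
  induction items with
  | nil => simp
  | cons a l ih =>
    simp only [List.map_cons, List.sum_cons, ih]
    push_cast
    ring

theorem rowSum_eq {ι : Type} (d : ℕ) (items : List ℕ) (w : ℕ → ℕ) (c : ι → ℕ → ℕ)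
    (i : ι) (l : List ι) :
    (rowSum (d * d * (items.map w).sum) (d * dot (items.map w) (items.map (c i)))
      (items.map fun t => w t * c i t)
      (l.map fun j => (d * dot (items.map w) (items.map (c j)), items.map (c j))) : ℤ) =
    (l.map fun j => |weightedEntry items w (fun i t => (c i t : ℤ) - d) i j|).sum := by
  induction l with
  | nil => rfl
  | cons j l ih =>
    rw [List.map_cons, List.map_cons, List.sum_cons, ← ih, weightedEntry_eq, ← absDiff_eq]
    simp only [rowSum, force_eq]
    rfl

theorem sum_le_formBound {ι : Type} (d : ℕ) (items : List ℕ) (w : ℕ → ℕ) (c : ι → ℕ → ℕ)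
    {G : ι → ι → ℝ} (hs : ∀ i j, G i j = G j i) (hdiag : ∀ i, G i i = 1)
    (hoff : ∀ i j, i ≠ j → |G i j| ≤ 1 / 2) (l : List ι) (hl : l.Nodup) :
    (l.map fun i => (l.map fun j =>
      (weightedEntry items w (fun i t => (c i t : ℤ) - d) i j : ℝ) * G i j).sum).sum ≤
    formBound (d * d * (items.map w).sum) (items.map w)
      (l.map fun j => (d * dot (items.map w) (items.map (c j)), items.map (c j))) := by
  set M := weightedEntry items w (fun i t => (c i t : ℤ) - d) with hM
  have hMs : ∀ i j, M i j = M j i := by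
    intro i j
    simp only [hM, weightedEntry]
    congr 1
    refine List.map_congr_left fun t _ => by ring
  induction l with
  | nil => simp [formBound]
  | cons i l ih =>
    obtain ⟨hi, hl⟩ := List.nodup_cons.mp hl
    have hrow := rowSum_eq d items w c i (i :: l)
    simp only [List.map_cons, List.sum_cons, formBound, forceMap_eq force_eq, zipWith_map_mul,
      List.map_map] at hrow ⊢
    simp only [Function.id_comp]
    have hsplit : (l.map fun a => (M a i : ℝ) * G a i +
        (l.map fun j => (M a j : ℝ) * G a j).sum).sum =
        (l.map fun a => (M i a : ℝ) * G i a).sum +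
        (l.map fun a => (l.map fun j => (M a j : ℝ) * G a j).sum).sum := by
      rw [List.sum_map_add]
      congr 2
      refine List.map_congr_left fun a _ => by rw [hMs a i, hs a i]
    rw [hsplit]
    have hnat : ∀ x y : ℕ, ((Nat.add x y : ℕ) : ℝ) = (x : ℝ) + y := fun x y => Nat.cast_add x y
    rw [hnat]
    have hR : ((rowSum (d * d * (items.map w).sum) (d * dot (items.map w) (items.map (c i)))
      (items.map fun t => w t * c i t)
      ((d * dot (items.map w) (items.map (c i)), items.map (c i)) ::
        l.map fun j => (d * dot (items.map w) (items.map (c j)), items.map (c j))) : ℕ) : ℝ) =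
        |(M i i : ℝ)| + (l.map fun j => |(M i j : ℝ)|).sum := by
      have := congrArg (Int.cast : ℤ → ℝ) hrow
      rw [Int.cast_natCast] at this
      rw [this]
      push_cast [List.map_map]
      simp only [Function.comp_def, Int.cast_abs, ← hM]
    have h2 : (l.map fun a => (M i a : ℝ) * G i a).sum ≤
        (l.map fun a => (1 / 2) * |(M i a : ℝ)|).sum := by
      refine List.sum_le_sum fun a ha => ?_
      have h3 := hoff i a (by rintro rfl; exact hi ha)
      calc (M i a : ℝ) * G i a ≤ |(M i a : ℝ) * G i a| := le_abs_self _
        _ = |(M i a : ℝ)| * |G i a| := abs_mul _ _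
        _ ≤ |(M i a : ℝ)| * (1 / 2) := by gcongr
        _ = _ := by ring
    rw [List.sum_map_mul_left] at h2
    have h4 : (M i i : ℝ) * G i i ≤ |(M i i : ℝ)| := by
      rw [hdiag, mul_one]; exact le_abs_self _
    have h5 := ih hl
    rw [hR]
    linarith

theorem not_listRealizable_of_valid {d : ℕ} {b items : List ℕ} (h : valid d b items = true) :
    ¬ ListRealizable d b := by
  rintro ⟨f, rfl, hgcd, G, hs, hdiag, hG⟩
  simp only [valid, forceMap_eq force_eq, force_eq, columns_eq, Bool.and_eq_true, List.all_eq_true,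
    Nat.blt_eq] at h
  obtain ⟨⟨-, hk⟩, hlt⟩ := h
  by_cases hd : d = 0
  · subst hd
    simp at hlt
  replace hd := Nat.pos_of_ne_zero hd
  set w : ℕ → ℕ := fun t => t / 32768
  set c : Fin 9 → ℕ → ℕ := fun i t => coord d (f i) i t with hc
  have hidx : (List.ofFn f).zipIdx = (List.finRange 9).map fun i => (f i, (i : ℕ)) := by
    simp [List.ofFn_succ, List.finRange_succ]
  rw [hidx, List.map_map] at hlt
  have hbound := sum_le_formBound d items w c hs hdiag
    (fun i j hij => abs_le_half_of_minimal hd hs hdiag hG hij) (List.finRange 9)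
    (List.nodup_finRange 9)
  have h1 : ((d : ℝ) ^ 2 * (items.map w).sum) ≤
      ∑ i, ∑ j, (weightedEntry items w (fun i t => (c i t : ℤ) - d) i j : ℝ) * G i j := by
    clear hbound hlt
    induction items with
    | nil => simp [weightedEntry]
    | cons t items ih =>
      have ih := ih fun x hx => hk x (List.mem_cons_of_mem _ hx)
      have ht := hk t List.mem_cons_self
      have h2 := hG (fun i => (c i t : ℤ) - d) ?_ ⟨(t / 512 % 64 : ℕ), fun i => coord_bound ..⟩
      · have hw : (0 : ℝ) ≤ w t := Nat.cast_nonneg _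
        have h3 := mul_le_mul_of_nonneg_left h2 hw
        simp only [weightedEntry, List.map_cons, List.sum_cons] at ih ⊢
        push_cast at ih h3 ⊢
        simp only [add_mul, Finset.sum_add_distrib]
        simp only [Finset.mul_sum] at h3
        simp only [← mul_assoc] at h3
        linarith
      · intro h0
        have := hgcd (t / 512 % 64 : ℕ) fun i => by
          have h4 := coord_bound d (f i) i t
          rw [show ((coord d (f i) i t : ℕ) : ℤ) - d = 0 from congrFun h0 i, zero_sub,
            dvd_neg] at h4
          exact h4
        have := Nat.le_of_dvd ht.1 (Int.natCast_dvd_natCast.mp this)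
        omega
  rw [← Fin.sum_univ_def] at hbound
  simp_rw [← Fin.sum_univ_def] at hbound
  have h6 := h1.trans hbound
  have h7 : ((d * d * (items.map w).sum : ℕ) : ℝ) ≤ _ := le_trans (by push_cast; linarith) h6
  exact absurd (Nat.cast_le.mp h7) (not_le.mpr hlt)

/-- Certificates excluding codes modulo `5`. -/
def certificates5 : List (List ℕ × List ℕ) := [
  ([0, 0, 1, 1, 1, 1, 2, 2, 2], [33280, 34244, 34256, 34248, 34272, 33344, 33536, 33408])]

/-- Certificates excluding codes modulo `6`. -/
def certificates6 : List (List ℕ × List ℕ) := [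
  ([0, 0, 1, 1, 1, 2, 2, 2, 3], [33280, 34016, 34312, 34308, 33536, 34320, 33600, 33664, 33568]),
  ([0, 1, 1, 1, 1, 1, 1, 3, 3], [131584, 131968, 33816, 33812, 131712, 131840, 33840, 33872,
    33810]),
  ([0, 1, 1, 1, 1, 1, 2, 3, 3], [33280, 33872, 33888, 33536, 33664, 33408, 33858, 33864, 33860]),
  ([0, 1, 1, 1, 1, 2, 2, 2, 2], [33280, 34272, 34314, 34310, 34316, 33344, 33536, 33408, 33312])]

/-- Certificates excluding codes modulo `7`. -/
def certificates7 : List (List ℕ × List ℕ) := [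
  ([0, 1, 1, 1, 1, 2, 2, 3, 3], [98816, 99808, 98944, 99072, 34216, 33344, 34424, 33312, 33664,
    34248, 34256, 34224]),
  ([0, 1, 1, 1, 1, 2, 3, 3, 3], [33280, 67040, 34248, 34256, 33536, 34242, 33344, 34244, 33408]),
  ([0, 1, 1, 1, 2, 2, 2, 3, 3], [33280, 34424, 34272, 33536, 34224, 34418, 34420, 33408, 34256]),
  ([1, 1, 1, 1, 1, 1, 3, 3, 3], [33280, 34241, 34256, 34248, 33344, 34242, 34244, 33536, 33408,
    34272]),
  ([1, 1, 1, 1, 1, 3, 3, 3, 3], [34272, 34288, 34274, 33408, 34280, 33312, 33344, 34276, 33536,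
    34273])]

/-- Certificates excluding codes modulo `8`. -/
def certificates8 : List (List ℕ × List ℕ) := [
  ([0, 0, 1, 1, 2, 2, 3, 3, 4], [33984, 34352, 34608, 34888, 34884, 34016, 66304, 34000]),
  ([0, 1, 1, 1, 1, 2, 2, 4, 4], [33280, 33664, 33888, 33408, 33536]),
  ([0, 1, 1, 1, 1, 2, 3, 3, 4], [66048, 33984, 33988, 66304, 66784, 34000, 33992, 33986]),
  ([0, 1, 1, 1, 1, 3, 3, 3, 3], [33280, 99808, 66176, 66304, 66080, 66112]),
  ([0, 1, 1, 1, 2, 2, 2, 3, 4], [33280, 33536, 33408, 33664, 34818, 34820, 34824, 34000, 33968,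
    34016]),
  ([0, 1, 1, 1, 2, 2, 3, 3, 3], [131584, 165428, 98880, 99808, 99792, 99072, 165432, 165426,
    98944]),
  ([0, 1, 1, 1, 2, 2, 3, 3, 4], [33280, 34352, 33536, 34000, 33664, 34616, 33600, 34016, 34610,
    34612]),
  ([0, 1, 1, 1, 2, 2, 3, 4, 4], [33856, 33904, 34818, 33872, 34824, 33888, 34820]),
  ([0, 1, 1, 1, 2, 3, 3, 3, 4], [33280, 34016, 34320, 33664, 34580, 34032, 33600, 33568, 34584,
    34578]),
  ([0, 1, 1, 2, 2, 2, 2, 3, 3], [33280, 34424, 34948, 34946, 34822, 34428, 34360, 34416, 34426,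
    34408, 34392]),
  ([0, 1, 1, 2, 2, 2, 3, 3, 4], [33280, 34360, 34884, 34616, 34882, 33536, 34000, 34016, 33992]),
  ([0, 1, 1, 2, 2, 3, 3, 4, 4], [33888, 34816, 34850, 34852, 33896, 33912, 33904]),
  ([1, 1, 1, 1, 1, 1, 2, 4, 4], [131584, 131968, 131712, 131840, 33858, 33864, 33888, 33872]),
  ([1, 1, 1, 1, 1, 1, 3, 3, 4], [66048, 33984, 66304, 34016, 33985, 33986, 33988, 34000, 33992]),
  ([1, 1, 1, 1, 1, 2, 2, 4, 4], [98816, 99200, 99424, 34821, 33864, 98944, 33858, 33840, 33872,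
    33826, 99072, 33832]),
  ([1, 1, 1, 1, 1, 2, 3, 3, 3], [98816, 33312, 99072, 99808, 98880, 98944, 34256, 34242, 34354,
    34356, 34244, 34342]),
  ([1, 1, 1, 1, 1, 2, 3, 3, 4], [98816, 99072, 33568, 34032, 33986, 66112, 66784, 66432, 33312,
    34000, 33988, 33985, 66176, 33992, 66368, 34024, 34020, 34018, 34017]),
  ([1, 1, 1, 1, 1, 2, 3, 4, 4], [33280, 33664, 66656, 33536, 33858, 33872, 33860, 33857, 33408,
    33864]),
  ([1, 1, 1, 1, 1, 3, 3, 3, 3], [34272, 66080, 66112, 66304, 66176, 34288, 34280, 34273, 34274,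
    34276]),
  ([1, 1, 1, 1, 1, 3, 3, 3, 4], [33280, 34016, 33536, 33408, 33600, 33344, 33568, 33664, 34020,
    33312, 34018, 34032, 34024, 34017]),
  ([1, 1, 1, 1, 2, 2, 2, 2, 4], [66048, 34544, 33536, 33600, 33568, 34819, 34822, 34821, 33664,
    33552]),
  ([1, 1, 1, 1, 2, 2, 2, 4, 4], [33280, 34819, 34821, 33536, 33840, 33408, 34822, 33872, 33888,
    33664]),
  ([1, 1, 1, 1, 2, 2, 3, 3, 3], [33280, 33536, 34353, 34354, 34272, 34360, 34356, 33344, 33408,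
    34256]),
  ([1, 1, 1, 1, 2, 2, 4, 4, 4], [33792, 34822, 34821, 34819, 33824, 33808, 33840]),
  ([1, 1, 1, 1, 2, 3, 3, 3, 3], [34272, 33408, 33344, 34288, 34328, 34321, 33312, 34324, 33536,
    34322]),
  ([1, 1, 1, 2, 2, 2, 2, 2, 3], [33280, 34552, 34819, 34821, 34822, 33536, 33312, 33288, 33344,
    33296, 33408]),
  ([1, 1, 1, 2, 2, 3, 4, 4, 4], [33824, 33848, 34818, 34817, 33832, 34820, 33840]),
  ([1, 1, 2, 2, 3, 3, 4, 4, 4], [33840, 34816, 33848, 34834, 34833, 33852, 33844])]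

/-- Certificates excluding codes modulo `9`. -/
def certificates9 : List (List ℕ × List ℕ) := [
  ([0, 1, 1, 1, 2, 2, 3, 4, 4], [66048, 99776, 67120, 67040, 68024, 67024, 68018, 68020]),
  ([0, 1, 1, 1, 2, 3, 3, 4, 4], [33280, 67040, 34320, 35220, 33536, 33408, 34288, 35218, 35224]),
  ([0, 1, 1, 2, 2, 3, 3, 4, 4], [33280, 34328, 35224, 35228, 34240, 35226, 33568, 34280, 34288,
    33440]),
  ([1, 1, 1, 1, 1, 2, 3, 4, 4], [328192, 99792, 295552, 295680, 197504, 66112, 198112, 99777,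
    99780, 99784]),
  ([1, 1, 1, 1, 1, 3, 3, 3, 4], [33280, 34272, 34305, 34308, 34312, 33536, 33664, 34306, 33600,
    33568, 34320]),
  ([1, 1, 1, 1, 1, 3, 3, 4, 4], [34272, 33408, 34240, 33536, 33312, 34280, 34276, 34288, 34273,
    34274, 33344, 34208]),
  ([1, 1, 1, 1, 2, 2, 2, 4, 4], [33280, 66304, 66176, 35313, 35320, 33296, 33312, 33344, 35316,
    35314]),
  ([1, 1, 1, 1, 2, 2, 3, 3, 4], [98816, 33536, 33568, 34256, 34272, 34354, 34356, 33408, 34360,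
    33344, 34353, 33600, 33664, 33552]),
  ([1, 1, 1, 1, 2, 2, 3, 4, 4], [98816, 33664, 99792, 34356, 98944, 99072, 35254, 33344, 34244,
    34354, 34224, 99808, 34242]),
  ([1, 1, 1, 1, 2, 2, 4, 4, 4], [33280, 34248, 33344, 33408, 33536, 67024, 67040, 34242, 34241,
    34244]),
  ([1, 1, 1, 1, 2, 3, 3, 3, 4], [33280, 34272, 33536, 33312, 34322, 34321, 33408, 34324, 33344,
    34576, 34328]),
  ([1, 1, 1, 1, 2, 3, 4, 4, 4], [34272, 33408, 33344, 67056, 34273, 34274, 33536, 34280, 33312,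
    34276, 34240]),
  ([1, 1, 1, 1, 3, 3, 3, 4, 4], [34288, 34305, 34224, 34312, 33408, 34306, 34308, 34256, 33536,
    34272]),
  ([1, 1, 1, 2, 2, 2, 3, 3, 3], [98816, 99896, 34330, 34332, 34256, 34329, 34248, 34873, 99072,
    98944, 98880, 34876, 34874, 34272]),
  ([1, 1, 1, 2, 2, 2, 3, 4, 4], [33280, 34360, 35257, 35258, 33408, 35260, 34272, 34256, 33536,
    34248]),
  ([1, 1, 1, 2, 2, 2, 4, 4, 4], [34360, 34248, 34256, 35321, 33536, 34272, 33408, 33344, 35322,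
    35324])]

/-- Certificates excluding codes modulo `10`. -/
def certificates10 : List (List ℕ × List ℕ) := [
  ([0, 1, 1, 1, 2, 3, 4, 4, 4], [165344, 99888, 98880, 99072, 98944, 67024, 33312]),
  ([0, 1, 1, 2, 2, 3, 3, 4, 4], [33280, 34272, 67192, 35224, 35364, 33536, 35362, 34416, 33408]),
  ([1, 1, 1, 1, 1, 3, 3, 4, 5], [98816, 99552, 33954, 33960, 33968, 33953, 99072, 33956, 33408,
    33664]),
  ([1, 1, 1, 1, 1, 3, 4, 4, 4], [66048, 132576, 98880, 34240, 98944, 99072, 66080]),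
  ([1, 1, 1, 1, 2, 2, 3, 4, 5], [98816, 99072, 33664, 33408, 66768, 66784, 33985, 33992, 33988,
    33986]),
  ([1, 1, 1, 1, 2, 2, 4, 4, 4], [33280, 67008, 34352, 33344, 35333, 35331, 33408, 33536, 35334,
    34272]),
  ([1, 1, 1, 1, 2, 2, 4, 4, 5], [33280, 99072, 66784, 66768, 33600, 33992, 33988, 33344, 66176,
    33986, 33985]),
  ([1, 1, 1, 1, 2, 3, 3, 3, 5], [66048, 34016, 34544, 33664, 66304, 34836, 33600, 33408, 33568,
    34840, 33344, 34835, 33312, 34800]),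
  ([1, 1, 1, 1, 2, 3, 3, 4, 4], [98816, 99808, 67184, 34256, 98944, 99072, 33664, 33312, 33344,
    34224]),
  ([1, 1, 1, 1, 2, 3, 3, 4, 5], [164352, 132320, 164608, 34680, 66432, 34418, 66176, 33600, 33344,
    66736, 34674, 66768, 34673, 34676, 34417, 34424, 34420]),
  ([1, 1, 1, 1, 2, 3, 4, 4, 5], [262656, 394464, 99888, 66760, 66754, 66753, 197840, 230144, 66756,
    99104, 197504, 98944, 98880, 99568, 197440, 33552]),
  ([1, 1, 1, 1, 2, 4, 4, 4, 4], [67040, 34320, 33408, 33536, 33344, 34288, 33312]),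
  ([1, 1, 1, 1, 3, 3, 3, 3, 5], [66048, 34544, 33552, 34548, 34545, 33664, 34546, 34552, 33600,
    34800, 33568]),
  ([1, 1, 1, 1, 3, 3, 3, 4, 5], [33280, 34420, 33408, 34417, 33968, 34424, 34016, 33536, 34418,
    34000, 34672]),
  ([1, 1, 1, 1, 3, 3, 4, 4, 4], [34288, 67120, 33408, 34256, 34272, 34356, 34354, 33536, 34360,
    33344]),
  ([1, 1, 1, 1, 3, 3, 4, 4, 5], [33280, 34032, 34352, 34612, 34616, 34000, 34016, 33664, 33600,
    34610, 34609]),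
  ([1, 1, 1, 1, 3, 4, 4, 4, 4], [67056, 34320, 34272, 34322, 33408, 33600, 34321, 34324, 33312,
    34328]),
  ([1, 1, 1, 2, 2, 2, 2, 4, 5], [98816, 99072, 66176, 34016, 66432, 34936, 33960, 33992, 33944,
    33968, 34000]),
  ([1, 1, 1, 2, 2, 2, 3, 3, 5], [66048, 34872, 66304, 34016, 33992, 34876, 34000, 34873, 34874]),
  ([1, 1, 1, 2, 2, 2, 3, 4, 4], [33280, 34424, 33536, 35329, 33408, 35330, 35332, 33344, 34248,
    34272, 34256]),
  ([1, 1, 1, 2, 2, 2, 4, 4, 5], [33280, 34360, 35333, 35331, 35334, 33536, 34000, 33344, 34016,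
    33408, 33992]),
  ([1, 1, 1, 2, 2, 3, 3, 3, 4], [66048, 34552, 35098, 35100, 34536, 33568, 34544, 33600, 33664,
    35097]),
  ([1, 1, 1, 2, 2, 3, 3, 4, 4], [98816, 99808, 99960, 34410, 33344, 34248, 99072, 34418, 98944,
    33312, 35226, 34216, 34224, 34256]),
  ([1, 1, 1, 2, 2, 3, 3, 4, 5], [98816, 66784, 34424, 99072, 33312, 34024, 34970, 66432, 34972,
    66176, 34032, 34969, 34842, 33992, 33568, 34000, 33600, 33968, 33344, 34844, 33960, 34680,
    34841]),
  ([1, 1, 1, 2, 2, 3, 4, 4, 4], [33280, 34272, 34360, 35333, 33344, 35334, 35331, 33536, 33408,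
    34256, 34248]),
  ([1, 1, 1, 2, 2, 4, 4, 4, 5], [34016, 34328, 35333, 35334, 35331, 33536, 33344, 34032, 33312,
    33408, 34024]),
  ([1, 1, 1, 2, 3, 3, 4, 4, 5], [66048, 99568, 99896, 34008, 33664, 33600, 99552, 34953, 34954,
    33344, 66304, 34024, 99536, 33408, 100152, 34892, 67785, 67786, 67788, 34889, 34040, 34890,
    34956, 34608, 34352]),
  ([1, 1, 1, 2, 3, 4, 4, 4, 4], [34288, 34328, 35334, 35331, 35333, 34280, 33312, 33408, 34272,
    33536, 33344]),
  ([1, 1, 1, 3, 3, 4, 4, 4, 5], [99576, 99864, 34016, 100120, 33568, 33600, 99560, 99568, 33664,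
    33312, 33344, 33408]),
  ([1, 1, 1, 3, 4, 4, 4, 4, 4], [132600, 132616, 68098, 68097, 67056, 68100, 35331, 35333, 35334]),
  ([1, 1, 2, 2, 2, 2, 2, 3, 5], [33280, 67708, 33540, 33552, 68097, 33536, 34943, 35456, 68098,
    33600, 33568, 33544]),
  ([1, 1, 2, 2, 2, 2, 3, 3, 4], [33280, 35132, 35394, 35393, 35331, 66304, 33288, 33344, 33284,
    33296, 33408, 33312]),
  ([1, 1, 2, 2, 2, 3, 3, 4, 4], [33280, 34272, 35228, 35362, 35361, 33536, 34424, 33408, 34412,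
    34420]),
  ([1, 1, 2, 3, 4, 4, 4, 4, 5], [34040, 34316, 35328, 35337, 35338, 33912, 66812, 35339, 34572,
    35330, 35329, 34032, 33976, 34008, 34024])]

/-- Certificates excluding codes modulo `11`. -/
def certificates11 : List (List ℕ × List ℕ) := [
  ([0, 1, 1, 2, 2, 3, 4, 4, 5], [98816, 132576, 132664, 164608, 131648, 131712, 98848, 68568]),
  ([1, 1, 1, 1, 2, 3, 3, 5, 5], [33280, 67040, 34416, 98944, 99072, 35217, 35224, 35218, 35220]),
  ([1, 1, 1, 1, 2, 3, 4, 4, 5], [98816, 99808, 99072, 34256, 98944, 98880, 66080, 34353, 34360,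
    34356, 34354]),
  ([1, 1, 1, 1, 2, 3, 4, 5, 5], [98816, 99808, 66304, 67024, 66176, 34248, 34244, 33664, 34241,
    34242]),
  ([1, 1, 1, 1, 2, 4, 4, 4, 5], [328192, 525792, 361216, 262720, 131968, 131872, 262784, 131904,
    262688]),
  ([1, 1, 1, 1, 3, 3, 3, 4, 5], [98816, 34417, 34424, 34418, 34420, 33408, 66304, 67040, 66992,
    67024]),
  ([1, 1, 1, 1, 3, 3, 3, 5, 5], [99952, 67040, 67972, 98944, 67024, 67969, 99072, 67970, 67976,
    66992]),
  ([1, 1, 1, 1, 3, 3, 4, 4, 5], [66048, 34352, 33344, 34256, 34272, 33408, 34356, 34354, 34360,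
    34608, 34353]),
  ([1, 1, 1, 1, 3, 3, 4, 5, 5], [99824, 131840, 132560, 132576, 67121, 131648, 67124, 131712,
    67128, 34224, 67122]),
  ([1, 1, 1, 2, 2, 2, 3, 5, 5], [35256, 99072, 98944, 34256, 34248, 35386, 34272, 33344, 35385,
    35388]),
  ([1, 1, 1, 2, 2, 2, 4, 4, 5], [131584, 67128, 67896, 230144, 132560, 197184, 132576, 131712,
    66432, 132552]),
  ([1, 1, 1, 2, 2, 2, 4, 5, 5], [34240, 35256, 34248, 66304, 34272, 35449, 34256, 33408, 35452,
    35450]),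
  ([1, 1, 1, 2, 2, 3, 3, 4, 5], [66048, 33536, 33664, 33600, 35097, 33568, 35098, 35100, 34416,
    34408, 35224]),
  ([1, 1, 1, 2, 2, 3, 3, 5, 5], [98816, 99808, 34424, 99072, 98944, 66432, 34224, 35226, 35225,
    34256, 35228]),
  ([1, 1, 1, 2, 2, 3, 4, 4, 4], [67040, 99896, 131712, 131648, 165424, 131840, 134108, 165416,
    134106, 134105]),
  ([1, 1, 1, 2, 2, 3, 4, 4, 5], [33280, 34272, 33536, 35545, 35546, 34616, 33664, 34352, 35548,
    34344, 33600]),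
  ([1, 1, 1, 2, 2, 3, 4, 5, 5], [34272, 35224, 33408, 34240, 35417, 34288, 33536, 34280, 35418,
    33312, 35420]),
  ([1, 1, 1, 2, 2, 4, 4, 4, 5], [34272, 34328, 35579, 33344, 35582, 35581, 33408, 34280, 33312,
    34288]),
  ([1, 1, 1, 2, 2, 4, 4, 5, 5], [33280, 34272, 35224, 35449, 34288, 34280, 33472, 35452, 33600,
    34208, 35450]),
  ([1, 1, 1, 2, 3, 3, 3, 4, 4], [66048, 67192, 34416, 34417, 33408, 34240, 34224, 33536, 34420,
    34418]),
  ([1, 1, 1, 2, 3, 3, 3, 4, 5], [33280, 34424, 35080, 35210, 33408, 35212, 33536, 34224, 34256,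
    35209, 34272]),
  ([1, 1, 1, 2, 3, 3, 4, 4, 5], [33280, 67128, 34356, 33536, 34272, 33344, 34256, 34354, 33408,
    34353, 34608]),
  ([1, 1, 1, 2, 3, 3, 4, 5, 5], [34288, 34360, 35208, 35273, 35274, 35276, 33536, 33344, 33408,
    34256, 34272]),
  ([1, 1, 1, 2, 3, 4, 4, 5, 5], [132592, 67096, 67976, 35241, 132576, 34320, 34224, 35434, 35273,
    67064, 34321, 35433, 35436, 66176, 34280, 66304, 34256]),
  ([1, 1, 1, 3, 3, 4, 4, 5, 5], [34328, 33312, 34332, 34280, 34329, 33344, 34288, 34330, 33408,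
    34456, 33536, 34584]),
  ([1, 1, 2, 2, 3, 3, 4, 4, 5], [33280, 33536, 34356, 35533, 34272, 35534, 34256, 34360, 35148,
    35212])]

/-- Certificates excluding codes modulo `12`. -/
def certificates12 : List (List ℕ × List ℕ) := [
  ([0, 1, 1, 2, 3, 3, 4, 5, 5], [66048, 67120, 100744, 68168, 34256, 67128, 34272]),
  ([1, 1, 1, 1, 2, 3, 4, 5, 6], [164352, 164608, 99200, 66768, 99552, 98944, 33988, 33992, 33986]),
  ([1, 1, 1, 1, 3, 3, 4, 4, 6], [66048, 34352, 34016, 34608, 34817, 34824, 33408, 33664, 34820,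
    34000, 66368, 34818]),
  ([1, 1, 1, 1, 3, 3, 4, 5, 5], [164352, 67008, 230960, 164480, 165344, 164608, 100738, 132560,
    66114]),
  ([1, 1, 1, 2, 2, 3, 3, 5, 6], [66048, 34968, 66304, 34972, 66176, 34970, 34969, 66432, 34840,
    66784]),
  ([1, 1, 1, 2, 2, 3, 4, 5, 5], [66048, 99776, 67992, 67040, 67120, 68188, 68185, 67112, 68186]),
  ([1, 1, 1, 2, 2, 3, 4, 5, 6], [98816, 99552, 99072, 33664, 66768, 66760, 33985, 33408, 33986,
    33988]),
  ([1, 1, 1, 2, 2, 3, 5, 5, 6], [98816, 99552, 33536, 66760, 66768, 33408, 33988, 66368, 33664,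
    33985, 33986]),
  ([1, 1, 1, 2, 2, 4, 5, 5, 5], [67040, 35288, 33408, 34320, 35385, 33536, 35386, 33344, 35388,
    34312]),
  ([1, 1, 1, 2, 3, 4, 5, 5, 6], [33280, 66784, 35018, 66800, 34000, 34024, 33984, 33536, 34584,
    35020, 34328, 35017]),
  ([1, 1, 2, 2, 2, 2, 4, 5, 5], [33280, 35452, 33344, 34256, 34248, 34272, 35388, 34244, 68221,
    68222]),
  ([1, 1, 2, 2, 2, 3, 3, 4, 6], [98816, 35484, 68642, 99072, 35843, 68641, 34828, 34016, 34840,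
    35740, 34836]),
  ([1, 1, 2, 2, 2, 3, 3, 5, 5], [229888, 199196, 100895, 164480, 164608, 199197, 199198, 68188,
    68156]),
  ([1, 1, 2, 2, 2, 3, 3, 5, 6], [66048, 35613, 35614, 34956, 33536, 34968, 33664, 34964, 34844,
    33600, 33568]),
  ([1, 1, 2, 2, 3, 3, 3, 4, 5], [66048, 35084, 35468, 34420, 35470, 34424, 35469, 33536, 34224,
    34240]),
  ([1, 1, 2, 2, 3, 3, 4, 4, 6], [33280, 34828, 35857, 33536, 34360, 35858, 33408, 34608, 35788,
    33344, 34356]),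
  ([1, 1, 2, 2, 3, 3, 4, 5, 5], [33280, 35212, 34360, 68173, 33536, 35406, 34256, 34272, 33408,
    34356]),
  ([1, 1, 2, 2, 3, 3, 5, 5, 6], [33280, 35020, 35340, 35597, 34000, 35598, 34016, 33664, 33600,
    34616, 34612]),
  ([1, 1, 2, 2, 3, 4, 5, 5, 6], [33280, 34016, 35020, 35372, 34032, 35630, 34580, 33600, 34584,
    33664, 35629]),
  ([1, 1, 2, 3, 3, 4, 5, 5, 6], [34328, 35012, 34032, 34332, 35366, 34024, 33536, 33344, 33408,
    35365, 35620]),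
  ([1, 2, 2, 2, 2, 3, 3, 4, 5], [197120, 264862, 101472, 68673, 68127, 197248, 133791, 197376,
    68641, 133662]),
  ([1, 2, 2, 2, 2, 3, 3, 5, 6], [33920, 35358, 34970, 35359, 34966, 35615, 35872, 35904, 34972,
    35614, 34958])]

/-- Certificates excluding codes modulo `13`. -/
def certificates13 : List (List ℕ × List ℕ) := [
  ([0, 1, 1, 2, 3, 4, 5, 5, 6], [34272, 35288, 36136, 67128, 35562, 35564, 34288, 33344, 33408]),
  ([1, 1, 1, 1, 3, 3, 5, 5, 6], [66048, 67008, 67120, 67024, 67040, 66304, 34608]),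
  ([1, 1, 1, 1, 3, 4, 4, 6, 6], [131584, 329184, 132720, 166288, 133522, 133528, 133521, 133524]),
  ([1, 1, 1, 1, 3, 4, 5, 5, 6], [66048, 361952, 329264, 198448, 98880, 98944, 67024, 66304,
    165312]),
  ([1, 1, 1, 2, 2, 3, 4, 6, 6], [295424, 133560, 68184, 262912, 262784, 230880, 197504]),
  ([1, 1, 1, 2, 2, 3, 5, 5, 6], [131584, 99776, 68314, 67040, 67120, 68313, 68316, 67112, 68568]),
  ([1, 1, 1, 2, 2, 4, 4, 5, 6], [131584, 132576, 67992, 131840, 98944, 66432, 67176, 67184, 68986]),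
  ([1, 1, 1, 2, 2, 4, 4, 6, 6], [67040, 35224, 34408, 34416, 99072, 36348, 98944, 36345, 36346]),
  ([1, 1, 1, 2, 2, 4, 5, 5, 5], [393728, 361952, 295488, 198200, 295680, 132560, 295552, 132552]),
  ([1, 1, 1, 2, 2, 4, 5, 5, 6], [67040, 35288, 66304, 36153, 33408, 66112, 33664, 36156, 36154,
    34344, 34352]),
  ([1, 1, 1, 2, 3, 3, 4, 5, 6], [66048, 34416, 34256, 33536, 35529, 33600, 33408, 35530, 33664,
    67896, 34272, 35532]),
  ([1, 1, 1, 2, 3, 3, 4, 6, 6], [66048, 99776, 67184, 133560, 68017, 68020, 68018, 67024, 67040]),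
  ([1, 1, 1, 2, 3, 3, 5, 5, 6], [33280, 34352, 35530, 34272, 35256, 35192, 35529, 33536, 35532,
    67024]),
  ([1, 1, 1, 2, 3, 3, 5, 6, 6], [99776, 67120, 68088, 67040, 68024, 68172, 67024, 68169, 68170]),
  ([1, 1, 1, 2, 3, 4, 4, 4, 6], [98816, 165616, 100632, 101866, 99072, 101868, 100088, 101865,
    67568]),
  ([1, 1, 1, 2, 3, 4, 4, 5, 6], [98816, 67040, 34418, 66304, 67192, 33344, 34256, 34420, 34417,
    66176, 34224, 34672]),
  ([1, 1, 1, 2, 3, 4, 4, 6, 6], [33280, 67040, 34416, 67992, 34288, 33536, 35217, 35220, 33408,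
    35218]),
  ([1, 1, 1, 2, 3, 4, 5, 5, 5], [198112, 165424, 34360, 131840, 68553, 131712, 131648, 131616,
    68588, 68586, 132592]),
  ([1, 1, 1, 2, 3, 4, 5, 5, 6], [131584, 329184, 361216, 328320, 198096, 328256, 132657, 263736,
    263664, 197152, 132658, 132660]),
  ([1, 1, 1, 2, 3, 4, 5, 6, 6], [99808, 33408, 33536, 99824, 33344, 35224, 34280, 34360, 35289,
    35290, 35292]),
  ([1, 1, 1, 2, 4, 4, 4, 6, 6], [67184, 35208, 36346, 34224, 33408, 36348, 34272, 36345, 33536,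
    34256]),
  ([1, 1, 1, 2, 4, 4, 5, 5, 6], [67056, 34352, 33344, 67128, 34608, 34272, 34353, 34356, 33536,
    34354, 33408]),
  ([1, 1, 1, 3, 3, 3, 4, 5, 5], [33280, 67192, 35256, 35777, 34408, 35778, 34416, 33408, 33536,
    35780]),
  ([1, 1, 1, 3, 3, 4, 4, 5, 6], [66048, 67040, 67192, 35224, 33408, 66304, 34680, 35226, 35225,
    35228]),
  ([1, 1, 1, 3, 3, 4, 5, 5, 6], [98816, 132576, 296504, 197376, 197248, 197184, 67016, 98848,
    99792, 99824, 132584]),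
  ([1, 1, 1, 3, 3, 4, 5, 6, 6], [67040, 67128, 100824, 66304, 66112, 66176, 68058, 68057, 67992,
    68060]),
  ([1, 1, 1, 3, 3, 5, 5, 6, 6], [132576, 132632, 131840, 131712, 133730, 133732, 133729, 166328,
    166360]),
  ([1, 1, 1, 3, 4, 4, 5, 6, 6], [591344, 525816, 297420, 230872, 197184, 329184, 329168, 297417,
    230888, 493960, 297418]),
  ([1, 1, 2, 2, 3, 3, 4, 4, 6], [98816, 36316, 35124, 69069, 34256, 35128, 66304, 33408, 35404,
    34272, 36332, 35468, 69070]),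
  ([1, 1, 2, 2, 3, 3, 4, 5, 5], [66048, 35788, 34424, 33536, 33344, 34272, 35790, 35789, 34256,
    35724, 34420]),
  ([1, 1, 2, 2, 3, 3, 4, 5, 6], [33280, 35260, 36172, 33408, 35534, 34420, 35533, 34272, 34256,
    34424]),
  ([1, 1, 2, 2, 3, 3, 4, 6, 6], [66048, 35260, 35404, 33408, 35256, 34272, 34256, 35252, 36302,
    36301]),
  ([1, 1, 2, 2, 3, 3, 5, 6, 6], [34240, 34352, 35324, 35404, 34272, 33408, 35406, 33536, 34256,
    35260, 35405]),
  ([1, 1, 2, 2, 3, 4, 4, 5, 6], [33280, 34272, 35228, 36204, 33536, 34424, 34420, 34256, 34224,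
    36222, 36221]),
  ([1, 1, 2, 2, 3, 4, 5, 5, 6], [34272, 35292, 36140, 35565, 35566, 34360, 33344, 33408, 34356,
    34288]),
  ([1, 1, 2, 3, 3, 4, 4, 5, 6], [66048, 34272, 67192, 67996, 35556, 36196, 33408, 33536, 35100,
    34224, 34256, 34428, 34216, 34680, 34248])]

/-- Certificates excluding codes modulo `14`. -/
def certificates14 : List (List ℕ × List ℕ) := [
  ([1, 1, 1, 1, 3, 4, 5, 6, 6], [393728, 460256, 460336, 166288, 427456, 165280, 165360, 66144,
    198096]),
  ([1, 1, 1, 2, 2, 4, 5, 6, 6], [33280, 67040, 34240, 34256, 33408, 33536, 35448, 33344, 34248]),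
  ([1, 1, 1, 2, 3, 3, 5, 6, 6], [98816, 165312, 165424, 100792, 199240, 164480, 164608, 67504]),
  ([1, 1, 1, 2, 3, 4, 4, 6, 6], [131584, 132720, 133528, 134660, 134657, 134658, 100752, 132728,
    67024]),
  ([1, 1, 1, 2, 3, 4, 5, 5, 6], [98816, 67040, 67120, 66304, 66176, 34608, 66112, 67128, 34256,
    34356, 34354]),
  ([1, 1, 1, 2, 3, 4, 5, 6, 6], [164352, 165424, 133528, 164608, 164480, 166473, 198080, 99792,
    166476, 166474, 199272]),
  ([1, 1, 1, 2, 3, 4, 6, 6, 6], [99808, 34352, 35288, 35336, 33344, 33536, 67024, 33408, 35368]),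
  ([1, 1, 1, 2, 3, 5, 5, 6, 6], [66048, 165344, 99856, 35224, 66176, 67056, 68201, 66304, 68204,
    68202]),
  ([1, 1, 1, 2, 4, 4, 5, 6, 6], [33280, 34352, 35208, 33536, 34360, 34256, 33408, 34272, 34224]),
  ([1, 1, 1, 3, 3, 4, 4, 5, 6], [98816, 67040, 67192, 67864, 67176, 67992, 66176, 67184, 66304]),
  ([1, 1, 1, 3, 3, 4, 5, 6, 6], [66048, 67040, 67128, 35224, 66304, 33344, 67024, 66176, 67016]),
  ([1, 1, 1, 3, 4, 5, 6, 6, 6], [198128, 198168, 68040, 99808, 34280, 68129, 68132, 66176, 68130,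
    66304]),
  ([1, 1, 2, 2, 2, 3, 5, 6, 6], [262656, 165312, 199260, 69020, 69153, 197376, 197248, 230880,
    131648]),
  ([1, 1, 2, 2, 2, 4, 5, 5, 6], [33280, 34272, 35548, 36156, 33536, 34240, 34352, 34340, 34344]),
  ([1, 1, 2, 2, 3, 3, 4, 6, 6], [33280, 34240, 34416, 35340, 35252, 33408, 35404, 35256, 33536]),
  ([1, 1, 2, 2, 3, 3, 5, 5, 6], [133836, 101644, 99896, 99792, 131712, 131648, 99808, 133838,
    99892, 133837]),
  ([1, 1, 2, 2, 3, 4, 4, 5, 6], [66048, 34272, 34416, 35468, 36204, 36369, 33680, 66304, 34424,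
    36370, 34420, 33408]),
  ([1, 1, 2, 2, 3, 4, 5, 5, 6], [33280, 34272, 35532, 36140, 33408, 35885, 33536, 33344, 34360,
    35886, 67124]),
  ([1, 1, 2, 2, 3, 4, 5, 6, 6], [33280, 34272, 34352, 35404, 36354, 36353, 35436, 33472, 35220,
    35224, 33600]),
  ([1, 1, 2, 2, 3, 5, 5, 6, 6], [33280, 34272, 35436, 36236, 34288, 35438, 33344, 34328, 33312,
    35437, 34324]),
  ([1, 1, 2, 2, 3, 5, 6, 6, 6], [99808, 34320, 68140, 33344, 33408, 33536, 35365, 35284, 35366]),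
  ([1, 1, 2, 2, 4, 5, 5, 6, 6], [34288, 67088, 35436, 36252, 36385, 36386, 34324, 33408, 33536,
    34272]),
  ([1, 1, 2, 3, 3, 4, 4, 4, 6], [66048, 34552, 100636, 36362, 36361, 33600, 33664, 33568, 36068]),
  ([1, 1, 2, 3, 3, 4, 4, 5, 6], [66048, 34424, 67868, 36196, 34408, 35524, 34416, 35224, 35492,
    33664, 35096, 34972]),
  ([1, 1, 2, 3, 3, 4, 5, 5, 6], [33280, 34360, 35100, 68292, 36132, 35556, 35224, 34352, 35160,
    34364, 34344]),
  ([1, 1, 2, 3, 4, 4, 4, 5, 6], [33280, 67192, 35084, 33408, 36354, 67196, 36353, 35080, 34256,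
    35212, 34224, 34272]),
  ([1, 1, 2, 3, 4, 4, 5, 6, 6], [34360, 35396, 36276, 36362, 34280, 34352, 33408, 33536, 34264,
    34364, 36361]),
  ([1, 1, 2, 3, 4, 5, 6, 6, 6], [34288, 34328, 35276, 35364, 35380, 33408, 67040, 33536, 33344,
    35365, 35366]),
  ([1, 1, 3, 4, 4, 5, 6, 6, 6], [67064, 99868, 100804, 68128, 69122, 36353, 67228, 67164, 67356,
    34328]),
  ([1, 1, 3, 4, 5, 6, 6, 6, 6], [132600, 35300, 100880, 101890, 101889, 99824, 68120, 69124])]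

/-- Certificates excluding codes modulo `15`. -/
def certificates15 : List (List ℕ × List ℕ) := [
  ([1, 1, 1, 2, 3, 4, 5, 6, 7], [262656, 263648, 99888, 264600, 262912, 100144, 133464, 263616,
    99744, 67024, 68908, 67988]),
  ([1, 1, 1, 2, 3, 4, 5, 7, 7], [165344, 132656, 264600, 361920, 132560, 132592, 230816, 133524,
    133522, 133521]),
  ([1, 1, 1, 2, 3, 4, 6, 6, 7], [67040, 67120, 35337, 99776, 33536, 35338, 35160, 35340, 35224,
    34280]),
  ([1, 1, 1, 2, 4, 4, 4, 6, 7], [164352, 165488, 199048, 67192, 100208, 131712, 197376, 99760,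
    99776]),
  ([1, 1, 1, 2, 4, 4, 5, 6, 7], [33280, 67120, 35208, 35400, 34616, 34272, 33536, 34256, 34360,
    34608, 35200]),
  ([1, 1, 1, 2, 4, 4, 5, 7, 7], [98816, 99888, 199048, 67968, 230880, 100740, 198096, 100737,
    100738]),
  ([1, 1, 1, 2, 4, 4, 6, 6, 6], [67120, 35336, 34272, 36857, 34256, 34360, 36860, 36858]),
  ([1, 1, 1, 2, 4, 4, 6, 6, 7], [67056, 132656, 35272, 69371, 69373, 66112, 66176, 132560, 132576,
    69374]),
  ([1, 1, 1, 3, 3, 3, 5, 7, 7], [66048, 166328, 68160, 164608, 99792, 164480, 99808, 99784]),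
  ([1, 1, 1, 3, 3, 4, 5, 6, 7], [66048, 67040, 67128, 67992, 35393, 66304, 35396, 66176, 35648,
    67112, 67120]),
  ([1, 1, 1, 3, 4, 4, 4, 6, 6], [98816, 67192, 100744, 99952, 34952, 33408, 33536, 35080]),
  ([1, 1, 1, 3, 4, 4, 5, 6, 7], [131584, 132664, 100744, 67024, 67977, 66304, 67978, 99808, 67980,
    67016, 67384]),
  ([1, 1, 1, 3, 4, 4, 6, 6, 7], [67128, 100808, 67912, 68098, 67120, 66304, 67976, 68097, 68100]),
  ([1, 1, 1, 3, 4, 5, 6, 6, 7], [67056, 132632, 68040, 66304, 35361, 66176, 35364, 67088, 35616,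
    66112]),
  ([1, 1, 1, 4, 4, 6, 6, 6, 7], [34296, 34328, 35328, 34584, 34280, 34288]),
  ([1, 1, 2, 2, 3, 3, 4, 7, 7], [590336, 557696, 166328, 557824, 166324, 459648, 230880, 134605,
    230864, 134606]),
  ([1, 1, 2, 2, 3, 3, 5, 6, 7], [34240, 35404, 36108, 34256, 36237, 66304, 33408, 35252, 34272,
    35256, 36238]),
  ([1, 1, 2, 2, 3, 3, 5, 7, 7], [66048, 99776, 68172, 69004, 68024, 34272, 69005, 69006, 68020]),
  ([1, 1, 2, 2, 3, 4, 4, 6, 7], [66048, 67184, 68108, 68972, 67988, 99072, 67992, 66976, 67008]),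
  ([1, 1, 2, 2, 3, 4, 4, 7, 7], [67184, 68108, 69100, 69229, 99744, 67988, 67992, 67008, 69230]),
  ([1, 1, 2, 2, 3, 4, 5, 6, 6], [66048, 67040, 67120, 68172, 35884, 66176, 35224, 35220, 66304]),
  ([1, 1, 2, 2, 3, 4, 5, 6, 7], [66048, 34272, 34352, 35404, 36140, 36526, 36525, 35220, 35224,
    34240]),
  ([1, 1, 2, 2, 3, 4, 5, 7, 7], [67040, 34352, 35404, 36268, 33408, 35224, 36397, 33536, 35220,
    36398]),
  ([1, 1, 2, 2, 3, 4, 6, 6, 7], [66048, 67040, 67120, 68108, 68908, 66112, 66368, 99072, 66176,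
    66432, 68056, 68052]),
  ([1, 1, 2, 2, 3, 5, 6, 6, 7], [67040, 34320, 35292, 35372, 36108, 33344, 34288, 33408, 35374,
    35373]),
  ([1, 1, 2, 2, 4, 4, 5, 7, 7], [67120, 68172, 69052, 67976, 66304, 67972, 69181, 66176, 69182,
    35264]),
  ([1, 1, 2, 2, 4, 5, 6, 6, 6], [67056, 67088, 68140, 69596, 34304, 67092, 67096, 34272]),
  ([1, 1, 2, 2, 4, 5, 6, 6, 7], [263664, 230928, 199212, 167644, 131968, 99808, 167646, 165656,
    131904, 167645, 165652]),
  ([1, 1, 2, 3, 3, 4, 4, 5, 7], [66048, 67868, 68228, 68964, 66304, 34416, 34408, 100632, 33664]),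
  ([1, 1, 2, 3, 3, 4, 4, 6, 7], [66048, 34272, 34424, 35228, 35332, 36196, 35224, 33408, 36598,
    36597, 33552, 33664, 33536]),
  ([1, 1, 2, 3, 3, 4, 5, 6, 7], [98816, 99808, 99896, 35228, 99072, 35397, 98944, 66112, 34356,
    34348, 35652, 67024, 67016]),
  ([1, 1, 2, 3, 4, 4, 5, 6, 6], [66048, 34360, 35212, 35396, 35892, 35208, 36790, 34272, 34256,
    36789]),
  ([1, 1, 2, 3, 4, 4, 5, 6, 7], [33280, 34360, 67980, 35396, 36148, 33536, 36534, 34256, 34272,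
    36533]),
  ([1, 1, 2, 3, 4, 4, 6, 6, 7], [66048, 99896, 35276, 99808, 67016, 66112, 35212, 35148, 66176,
    99792, 35334, 99072, 34356]),
  ([1, 1, 2, 3, 4, 5, 6, 6, 7], [99824, 99864, 35276, 98944, 98880, 35365, 67040, 99072, 67048,
    34324, 66080, 35620, 34332]),
  ([1, 1, 2, 4, 4, 5, 6, 6, 7], [67064, 34328, 35268, 35364, 34288, 36574, 36573, 34588, 35136,
    35200, 34332]),
  ([1, 1, 2, 4, 4, 6, 6, 6, 7], [67096, 68100, 102142, 33568, 67056, 33664, 67048, 35612, 102141]),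
  ([1, 1, 2, 4, 5, 6, 6, 6, 7], [165368, 165384, 133652, 36108, 69356, 99824, 102126, 102125,
    35584])]

/-- Certificates excluding codes modulo `16`. -/
def certificates16 : List (List ℕ × List ℕ) := [
  ([1, 1, 1, 2, 3, 4, 6, 7, 7], [132544, 67120, 99072, 98944, 132576, 66112, 34256, 68056, 67112]),
  ([1, 1, 1, 2, 3, 5, 6, 6, 7], [262656, 361952, 295680, 197248, 66432, 197184, 98848, 66368]),
  ([1, 1, 1, 2, 4, 5, 6, 7, 7], [296416, 394800, 166272, 134748, 230896, 131776, 100744, 131904,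
    134746, 134745]),
  ([1, 1, 1, 3, 4, 4, 5, 6, 7], [98816, 99960, 66176, 34416, 66304, 67024, 67976, 35529, 67040,
    35532, 35530]),
  ([1, 1, 2, 2, 3, 3, 6, 7, 7], [165312, 100988, 101772, 100984, 100980, 101965, 99808, 99792,
    101966]),
  ([1, 1, 2, 2, 3, 4, 5, 7, 7], [165312, 132720, 100956, 167468, 66176, 134702, 66304, 134701,
    100756, 100760]),
  ([1, 1, 2, 2, 3, 4, 6, 6, 7], [33280, 34352, 68316, 33536, 34272, 36865, 36866, 36140, 33600,
    33664, 35544]),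
  ([1, 1, 2, 2, 3, 4, 6, 7, 7], [1737216, 1246656, 1410608, 1543788, 1442560, 1442432, 1149332,
    1639904, 1149336, 1117742, 1117741]),
  ([1, 1, 2, 2, 3, 5, 5, 6, 7], [295424, 263648, 101740, 102028, 295680, 262784, 99960, 229920,
    229952, 99956]),
  ([1, 1, 2, 2, 3, 5, 6, 6, 6], [132576, 165424, 199724, 135116, 99872, 131840, 131712, 131648]),
  ([1, 1, 2, 2, 3, 5, 6, 6, 7], [229888, 427488, 133852, 328320, 328256, 361216, 165428, 295456,
    165432, 99824]),
  ([1, 1, 2, 2, 3, 5, 6, 7, 7], [295424, 951776, 296496, 461436, 232876, 393856, 233037, 393984,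
    361968, 197152, 233038]),
  ([1, 1, 2, 2, 4, 4, 5, 6, 7], [66048, 34416, 35532, 36541, 34272, 36931, 34256, 34424, 36542,
    34420]),
  ([1, 1, 2, 2, 4, 5, 6, 6, 7], [34272, 67120, 35564, 33408, 33344, 34360, 36899, 36574, 36573,
    34288]),
  ([1, 1, 2, 3, 3, 4, 4, 7, 7], [34424, 67992, 100892, 101988, 100764, 35352, 66176, 66304]),
  ([1, 1, 2, 3, 3, 4, 5, 6, 7], [33280, 34240, 68316, 35224, 33536, 36196, 36518, 36517, 34408,
    34416]),
  ([1, 1, 2, 3, 3, 4, 5, 7, 7], [198080, 133528, 166492, 132712, 134693, 132720, 134628, 134694,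
    100892]),
  ([1, 1, 2, 3, 4, 4, 5, 5, 7], [66048, 34552, 35080, 35532, 69172, 35084, 33536, 36406, 34256,
    34272]),
  ([1, 1, 2, 3, 4, 4, 5, 6, 6], [33280, 34424, 35788, 33344, 34272, 33536, 34416, 33408, 34420,
    34256]),
  ([1, 1, 2, 3, 4, 4, 5, 6, 7], [34424, 35532, 35208, 66304, 34256, 35212, 36533, 33408, 34272,
    36534, 36404]),
  ([1, 1, 2, 3, 4, 4, 5, 7, 7], [33280, 34424, 35208, 35404, 36404, 33536, 34272, 35212, 33408,
    34256]),
  ([1, 1, 2, 3, 4, 4, 6, 6, 7], [66048, 67128, 68300, 66304, 34248, 36148, 67040, 67024]),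
  ([1, 1, 2, 3, 4, 4, 6, 7, 7], [34360, 35208, 35404, 36468, 35212, 36405, 66176, 33536, 34256,
    34272, 36406]),
  ([1, 1, 2, 3, 4, 5, 6, 6, 7], [33280, 67128, 36132, 36564, 36897, 34608, 33344, 34364, 33408,
    34280, 36898]),
  ([1, 1, 2, 3, 4, 5, 6, 7, 7], [34272, 34360, 68204, 33536, 35272, 36276, 36438, 36437, 34352,
    33408]),
  ([1, 1, 2, 3, 5, 6, 6, 7, 7], [198128, 132632, 100988, 101780, 99832, 67088, 100989, 100972,
    100990]),
  ([1, 1, 3, 3, 4, 5, 5, 7, 7], [34272, 35212, 36369, 34420, 35404, 34424, 33408, 35372, 36370,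
    33536, 36336]),
  ([1, 1, 3, 4, 4, 5, 6, 7, 7], [35428, 33536, 34288, 35268, 67128, 35236, 35396, 33408, 34280,
    35429, 35430]),
  ([1, 1, 3, 4, 5, 6, 6, 7, 7], [34288, 34332, 35268, 34328, 35236, 34456, 34584, 68196, 36457,
    36458, 34300]),
  ([1, 2, 2, 2, 3, 4, 5, 6, 7], [197120, 68942, 200366, 36399, 69696, 69697, 102063, 67424, 67188,
    67192, 67186]),
  ([1, 2, 2, 2, 3, 5, 6, 6, 7], [66048, 34272, 36142, 69326, 36140, 36138, 36897, 36143, 36912,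
    36134, 35886]),
  ([1, 2, 2, 3, 4, 4, 5, 6, 7], [33280, 34424, 35534, 69302, 33408, 34272, 35212, 34256, 35210,
    36535, 33536]),
  ([1, 2, 2, 3, 4, 5, 6, 6, 7], [33280, 34360, 35566, 34288, 35562, 36502, 36897, 33568, 35564,
    36438, 34240])]

/-- Certificates excluding codes modulo `17`. -/
def certificates17 : List (List ℕ × List ℕ) := [
  ([0, 1, 2, 3, 4, 5, 6, 7, 8], [34272, 34360, 37204, 36276, 34352, 36566, 68204, 35288, 33408]),
  ([1, 1, 1, 2, 4, 4, 6, 7, 8], [623104, 394688, 395696, 592456, 494008, 558544, 430458, 426752,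
    430460, 430457]),
  ([1, 1, 1, 2, 4, 5, 5, 7, 8], [131584, 165344, 132720, 197376, 131712, 34240, 34208, 99792,
    99760]),
  ([1, 1, 1, 2, 4, 5, 6, 7, 8], [66048, 198112, 132656, 131840, 98944, 99776, 67376, 99792, 66992]),
  ([1, 1, 1, 2, 4, 5, 7, 7, 7], [132576, 230960, 100816, 99072, 98944, 98880]),
  ([1, 1, 1, 3, 3, 5, 5, 7, 8], [460256, 854424, 590592, 361888, 331396, 361920, 331394, 331393,
    657008, 525928]),
  ([1, 1, 1, 3, 3, 5, 6, 7, 8], [165344, 166296, 165312, 68900, 165352, 68897, 165360, 68898,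
    35160, 132512]),
  ([1, 1, 1, 3, 4, 4, 6, 6, 8], [918016, 525760, 887096, 723656, 233969, 722480, 887224, 557824,
    887160]),
  ([1, 1, 1, 3, 4, 4, 6, 7, 8], [164352, 198200, 166328, 199240, 132656, 166474, 166473, 166476,
    199496]),
  ([1, 1, 1, 3, 4, 5, 5, 7, 7], [33280, 34272, 34424, 35224, 33536, 33408, 34416]),
  ([1, 1, 1, 3, 4, 5, 6, 7, 8], [983552, 1377760, 1377848, 919960, 265504, 1311488, 821720, 819776,
    296400, 1214000, 1376896]),
  ([1, 1, 1, 3, 4, 5, 7, 7, 8], [329184, 427576, 592344, 199968, 168208, 393792, 493040, 393856,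
    198120]),
  ([1, 1, 1, 3, 4, 6, 6, 7, 8], [34328, 36096, 67056, 34320, 35256, 35436, 35433, 33408, 35434,
    35288]),
  ([1, 1, 2, 2, 3, 4, 5, 8, 8], [165312, 133552, 134604, 134700, 37293, 164480, 132576, 133560,
    164608, 133556]),
  ([1, 1, 2, 2, 3, 4, 6, 7, 8], [99776, 69292, 66304, 69997, 67040, 67376, 68180, 69998, 68184,
    68444]),
  ([1, 1, 2, 2, 3, 5, 5, 8, 8], [229888, 329184, 167404, 167436, 295680, 295552, 166292, 263040]),
  ([1, 1, 2, 2, 3, 5, 6, 6, 8], [131584, 132576, 134444, 131840, 67376, 68308, 98848, 68312]),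
  ([1, 1, 2, 2, 3, 5, 6, 7, 7], [197120, 230880, 102284, 230144, 230016, 197184, 164384, 99896,
    102348]),
  ([1, 1, 2, 2, 3, 5, 6, 7, 8], [66048, 34272, 34352, 36140, 35224, 36493, 34240, 34208, 36556,
    35220, 36494]),
  ([1, 1, 2, 2, 3, 6, 6, 7, 7], [197120, 99856, 166520, 165312, 165280, 166516, 134284, 135278,
    135277, 134412]),
  ([1, 1, 2, 2, 4, 4, 5, 7, 8], [819712, 657008, 332092, 918272, 559540, 659774, 787072, 559544,
    659773, 492352, 395852]),
  ([1, 1, 2, 2, 4, 4, 7, 7, 8], [164352, 67120, 102140, 102716, 35588, 168254, 69951, 99808, 68360,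
    99792, 168253]),
  ([1, 1, 2, 2, 4, 5, 5, 6, 8], [33280, 67184, 36204, 36508, 34240, 37278, 37277, 35096, 35092,
    34208]),
  ([1, 1, 2, 2, 4, 5, 5, 7, 8], [197120, 198256, 200044, 200348, 231280, 199064, 199060, 197376,
    132832]),
  ([1, 1, 2, 2, 4, 5, 6, 6, 8], [427488, 558640, 363820, 463324, 426752, 397789, 397790, 329268,
    263736]),
  ([1, 1, 2, 2, 4, 5, 6, 7, 7], [33280, 35404, 34256, 36959, 33536, 33408, 67124, 34360, 36766,
    36765]),
  ([1, 1, 2, 2, 4, 5, 6, 7, 8], [33280, 34352, 36140, 37213, 37214, 34608, 67008, 35224, 35220,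
    36572]),
  ([1, 1, 2, 2, 4, 5, 7, 7, 8], [67040, 34352, 37148, 33344, 35284, 36573, 36574, 33408, 35372,
    35288]),
  ([1, 1, 2, 2, 4, 6, 6, 7, 8], [296416, 165392, 430460, 393984, 430461, 430462, 364927, 230896]),
  ([1, 1, 2, 2, 5, 5, 6, 7, 8], [33280, 67120, 36156, 34272, 34256, 35208, 35204, 36556, 37198,
    37197]),
  ([1, 1, 2, 3, 3, 4, 5, 7, 8], [66048, 99776, 68024, 68124, 69286, 69540, 68188, 67184, 69285,
    67176]),
  ([1, 1, 2, 3, 3, 4, 6, 7, 8], [131584, 132544, 133560, 133724, 69284, 131840, 68444, 68022,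
    132576, 68012, 34256, 34442, 69998, 68997]),
  ([1, 1, 2, 3, 3, 5, 5, 7, 8], [35224, 35356, 33536, 36485, 36486, 34208, 34240, 34408, 34416,
    69092]),
  ([1, 1, 2, 3, 3, 5, 6, 7, 8], [34272, 35224, 35420, 69028, 33536, 36486, 34240, 34344, 36485,
    34352]),
  ([1, 1, 2, 3, 4, 4, 5, 6, 8], [66048, 34240, 35128, 35468, 35256, 37301, 34416, 36196, 37302,
    36180]),
  ([1, 1, 2, 3, 4, 4, 6, 6, 7], [131584, 67128, 133836, 69428, 68296, 67040, 99072, 67024]),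
  ([1, 1, 2, 3, 4, 4, 6, 6, 8], [98816, 67008, 68300, 68024, 66304, 67120, 67960, 68900, 68884]),
  ([1, 1, 2, 3, 4, 4, 6, 7, 8], [33280, 35256, 35404, 33536, 67024, 34272, 34352, 37238, 35252,
    37237, 37244]),
  ([1, 1, 2, 3, 4, 5, 5, 6, 7], [33280, 34272, 36628, 33536, 35500, 67184, 36757, 33408, 35224,
    36758, 35532]),
  ([1, 1, 2, 3, 4, 5, 5, 6, 8], [66048, 34272, 35096, 36196, 34160, 37270, 36500, 33536, 35100,
    37269, 35224]),
  ([1, 1, 2, 3, 4, 5, 5, 7, 8], [66048, 34272, 34424, 35224, 33536, 35372, 36502, 34416, 36501,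
    36756, 35404]),
  ([1, 1, 2, 3, 4, 5, 6, 7, 8], [66048, 34272, 34360, 35224, 36132, 33608, 33472, 33664, 35228,
    37205, 36564, 37206, 34608]),
  ([1, 1, 2, 3, 4, 5, 7, 7, 8], [67040, 34360, 35288, 37140, 36566, 36565, 35372, 33408, 35292,
    33344]),
  ([1, 1, 2, 3, 4, 6, 6, 7, 8], [34272, 67096, 35436, 36100, 37238, 36244, 34288, 37237, 34240,
    34208, 34584, 34280]),
  ([1, 1, 2, 4, 4, 6, 6, 7, 8], [164352, 165344, 165400, 199064, 166500, 168316, 99072, 165360,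
    165352, 166300]),
  ([1, 1, 2, 4, 5, 6, 7, 7, 8], [656920, 199112, 297508, 362264, 299310, 198112, 265556, 299309,
    394728, 265620, 394744])]

/-- Certificates excluding codes modulo `18`. -/
def certificates18 : List (List ℕ × List ℕ) := [
  ([1, 1, 1, 3, 4, 5, 6, 7, 8], [328192, 263648, 198192, 199064, 230144, 164480, 165432, 99792,
    100696]),
  ([1, 1, 2, 3, 3, 5, 6, 7, 8], [66048, 34272, 35224, 35548, 36132, 69284, 34240, 34344, 36517,
    34352]),
  ([1, 1, 2, 3, 3, 5, 7, 7, 8], [983552, 231896, 658140, 560420, 659172, 262784, 495333, 492416,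
    495334, 754496]),
  ([1, 1, 2, 3, 4, 4, 6, 7, 8], [164352, 132544, 132656, 133560, 133836, 37236, 131840, 68020,
    70153, 98944]),
  ([1, 1, 2, 3, 4, 5, 6, 7, 7], [98816, 67120, 68556, 68644, 69556, 101320, 66304, 66176, 69717,
    69718]),
  ([1, 1, 2, 3, 4, 5, 6, 7, 8], [33280, 34272, 35224, 35532, 33536, 36534, 36148, 36516, 36533,
    34256, 67128]),
  ([1, 1, 2, 3, 4, 5, 6, 8, 8], [66048, 35224, 35404, 33408, 34256, 36406, 34360, 35228, 36405,
    37387]),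
  ([1, 1, 2, 3, 5, 6, 7, 7, 8], [99824, 67088, 35272, 68332, 68884, 69332, 67096, 36096, 34296]),
  ([1, 1, 3, 3, 4, 5, 6, 7, 8], [33280, 35228, 68300, 36128, 69296, 37200, 34360, 35100, 34356,
    35564]),
  ([1, 1, 3, 4, 5, 6, 7, 8, 8], [329200, 394776, 395724, 526948, 298384, 331352, 135592, 165308,
    393984, 393856, 329236]),
  ([1, 2, 2, 2, 3, 5, 6, 7, 8], [131584, 132576, 134446, 265902, 135502, 131840, 102960, 66976,
    135246, 102945]),
  ([1, 2, 2, 3, 3, 4, 6, 7, 8], [33280, 34240, 35256, 36518, 35546, 33408, 35548, 34272, 33536,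
    36230]),
  ([1, 2, 2, 3, 3, 4, 7, 8, 8], [198080, 101766, 200294, 98976, 66336, 99824, 99816, 100954,
    101991, 100956]),
  ([1, 2, 2, 3, 4, 5, 6, 7, 8], [33280, 34272, 34352, 35224, 36534, 37206, 35530, 36518, 33536,
    35532]),
  ([1, 2, 3, 3, 3, 4, 5, 7, 8], [98816, 68254, 68930, 102114, 33536, 33664, 35484, 36546]),
  ([1, 2, 3, 3, 4, 4, 5, 6, 8], [66048, 67900, 68238, 68930, 69234, 66304, 35256, 35252, 35904]),
  ([1, 2, 3, 3, 4, 5, 6, 7, 8], [33280, 34272, 35228, 35534, 69298, 34256, 34360, 36514, 36146,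
    34356, 33536])]

/-- Certificates excluding codes modulo `19`. -/
def certificates19 : List (List ℕ × List ℕ) := [
  ([1, 1, 1, 3, 4, 5, 7, 7, 9], [99888, 166600, 134440, 68552, 102866, 102865, 102868]),
  ([1, 1, 1, 3, 4, 5, 7, 8, 9], [98816, 165344, 67120, 166296, 35400, 99072, 165312, 99792, 67928]),
  ([1, 1, 1, 3, 4, 6, 6, 8, 9], [198112, 264600, 68970, 230816, 230896, 230848, 198120, 68972,
    68969]),
  ([1, 1, 1, 3, 5, 5, 7, 7, 9], [98816, 99824, 329264, 232136, 201152, 230968, 231224, 99072]),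
  ([1, 1, 1, 3, 5, 5, 7, 8, 8], [329264, 199240, 296504, 99072, 132560, 164480, 132576]),
  ([1, 1, 1, 3, 5, 5, 7, 8, 9], [655872, 1508912, 919944, 461384, 1476064, 1476048, 787200, 984888,
    559560]),
  ([1, 1, 2, 2, 4, 5, 6, 8, 9], [66048, 67184, 67984, 69292, 69980, 67992, 99072, 67988, 132544]),
  ([1, 1, 2, 2, 4, 5, 7, 8, 8], [229888, 198112, 198192, 133708, 165328, 131712, 198080, 131840]),
  ([1, 1, 2, 2, 4, 5, 7, 8, 9], [197120, 460256, 198192, 133708, 134572, 135516, 197376, 394688,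
    198128, 230864]),
  ([1, 1, 2, 2, 4, 6, 7, 7, 9], [197120, 198112, 198192, 199980, 164608, 67028, 198448, 198080,
    67032]),
  ([1, 1, 2, 2, 4, 6, 7, 8, 8], [67040, 70588, 66304, 70590, 66176, 70589, 70591, 33312]),
  ([1, 1, 2, 2, 5, 5, 6, 8, 9], [67184, 67968, 69308, 69964, 67976, 67972, 33536, 34256, 34272]),
  ([1, 1, 2, 2, 5, 5, 7, 8, 8], [230960, 164480, 164608, 168013, 200636, 168014, 100932, 100936]),
  ([1, 1, 2, 2, 5, 5, 7, 8, 9], [165424, 102140, 102732, 99808, 99792, 132544, 100744, 100740,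
    100144]),
  ([1, 1, 2, 3, 3, 5, 7, 8, 9], [35420, 36284, 37188, 33408, 67008, 34352, 36581, 34344, 35288,
    36582]),
  ([1, 1, 2, 3, 3, 6, 7, 7, 8], [590336, 820704, 331068, 590368, 688768, 329264, 329256, 590592,
    688704]),
  ([1, 1, 2, 3, 4, 4, 6, 8, 9], [131584, 132544, 67184, 133560, 69068, 70004, 66120, 164608, 66176,
    68108]),
  ([1, 1, 2, 3, 4, 4, 7, 7, 9], [98816, 67008, 34352, 35128, 68300, 68876, 70132, 101064]),
  ([1, 1, 2, 3, 4, 5, 6, 7, 9], [66048, 34272, 34416, 35532, 36204, 35224, 37268, 34240, 37333,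
    37334, 35160]),
  ([1, 1, 2, 3, 4, 5, 6, 8, 8], [360960, 427488, 362096, 330136, 330316, 164392, 198068, 492288,
    492160]),
  ([1, 1, 2, 3, 4, 5, 6, 8, 9], [328192, 296416, 263792, 297368, 264780, 262784, 262912, 133676,
    133524, 133704]),
  ([1, 1, 2, 3, 4, 5, 7, 7, 8], [655872, 591328, 689712, 658124, 331052, 394808, 592584, 329268,
    525056]),
  ([1, 1, 2, 3, 4, 5, 7, 8, 9], [99808, 100760, 100940, 101804, 102740, 99776, 103061, 66080,
    99824, 103062, 100936]),
  ([1, 1, 2, 3, 4, 5, 8, 8, 9], [230880, 133592, 168212, 100872, 199132, 168661, 164672, 165360,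
    164736, 168662]),
  ([1, 1, 2, 3, 4, 6, 6, 8, 8], [98816, 67184, 67992, 67008, 69524, 68200, 66976, 68844, 68972]),
  ([1, 1, 2, 3, 4, 6, 6, 8, 9], [33280, 35224, 34240, 37622, 34208, 36500, 35432, 68972, 34672,
    37621]),
  ([1, 1, 2, 3, 4, 6, 7, 7, 8], [197120, 230880, 67120, 68908, 230016, 263736, 230144, 229952,
    197152]),
  ([1, 1, 2, 3, 4, 6, 7, 7, 9], [34272, 35564, 68904, 37332, 33408, 37430, 33344, 37429, 34360,
    34288]),
  ([1, 1, 2, 3, 4, 6, 7, 8, 8], [33280, 67040, 34352, 35224, 37813, 36140, 37814, 36820, 35432,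
    36012]),
  ([1, 1, 2, 3, 4, 6, 7, 8, 9], [33280, 67040, 35224, 36268, 37558, 34608, 37557, 35432, 36140,
    36564]),
  ([1, 1, 2, 3, 5, 5, 6, 7, 9], [33280, 35532, 36220, 67192, 35208, 36534, 37252, 36533, 34272,
    34256]),
  ([1, 1, 2, 3, 5, 5, 6, 8, 9], [33280, 34416, 35208, 35404, 36532, 33408, 34256, 33536, 34272,
    34424]),
  ([1, 1, 2, 3, 5, 5, 7, 8, 9], [67120, 35404, 36284, 37188, 33408, 35272, 34272, 34256, 36597,
    36598]),
  ([1, 1, 2, 3, 5, 6, 6, 8, 9], [66048, 35208, 37604, 34424, 36501, 35212, 36502, 34256, 34224,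
    36220]),
  ([1, 1, 2, 3, 5, 6, 7, 8, 9], [34288, 35436, 36284, 37188, 36566, 67128, 36565, 34272, 35272,
    33408]),
  ([1, 1, 2, 3, 5, 7, 7, 8, 8], [132592, 132624, 133740, 68200, 68202, 68201, 36232, 99864]),
  ([1, 1, 2, 4, 4, 5, 6, 7, 9], [67864, 35524, 36196, 37469, 67992, 33408, 37470, 66304, 35100,
    34416, 35228, 34408]),
  ([1, 1, 2, 4, 4, 6, 6, 8, 9], [1245696, 1181152, 788088, 592280, 1774332, 1708797, 1708798,
    1413887]),
  ([1, 1, 2, 4, 4, 6, 7, 7, 9], [34272, 36132, 37372, 34352, 35524, 33536, 37438, 37437, 34344,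
    35160, 35224]),
  ([1, 1, 2, 4, 5, 5, 6, 8, 8], [66048, 99960, 67976, 35396, 69556, 34272, 36789, 34256, 36790]),
  ([1, 1, 2, 4, 5, 5, 7, 8, 8], [66048, 165432, 133512, 166468, 66996, 99888, 69628, 132576,
    132560]),
  ([1, 1, 2, 4, 5, 6, 6, 8, 9], [164352, 460408, 395656, 298484, 198520, 332526, 329328, 332525,
    167268, 296572]),
  ([1, 1, 2, 4, 5, 6, 7, 8, 9], [34360, 36276, 37228, 34272, 68040, 37550, 33536, 34352, 37549,
    35396]),
  ([1, 1, 2, 4, 5, 6, 8, 8, 9], [34288, 34360, 68040, 36564, 37164, 34272, 66304, 37613, 35276,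
    37614]),
  ([1, 1, 3, 4, 4, 5, 6, 7, 9], [131584, 165496, 264476, 199364, 200036, 69280, 70104, 68480,
    199068]),
  ([1, 1, 3, 4, 5, 6, 7, 8, 9], [67128, 35212, 35428, 36276, 34364, 35684, 34616, 35272, 35396,
    33536, 37545, 37546]),
  ([1, 1, 3, 4, 6, 7, 7, 8, 9], [33280, 34288, 34328, 68212, 101780, 37240, 33600, 37352, 68196,
    34588, 33568]),
  ([1, 2, 3, 4, 5, 6, 7, 8, 9], [34288, 34360, 35212, 36278, 37226, 37546, 34240, 34356, 33536,
    37547, 34272, 35398, 34284, 34264])]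

/-- Certificates excluding codes modulo `20`. -/
def certificates20 : List (List ℕ × List ℕ) := [
  ([1, 1, 2, 3, 5, 6, 8, 8, 8], [34272, 99888, 69588, 33536, 67128, 33344, 33408]),
  ([1, 1, 3, 4, 5, 6, 6, 8, 8], [66048, 34272, 67192, 35212, 35940, 69520, 34216, 34248, 67196]),
  ([1, 2, 2, 3, 4, 5, 6, 8, 9], [98816, 34416, 35224, 36518, 37142, 35402, 34272, 70359, 66432,
    35404, 33600]),
  ([1, 2, 2, 3, 4, 5, 7, 8, 9], [67008, 67120, 67992, 69286, 102742, 70295, 66304, 68172, 68170,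
    67040]),
  ([1, 2, 2, 3, 4, 5, 8, 8, 9], [33280, 34240, 34352, 35288, 36582, 37142, 37590, 34272, 33536,
    37591]),
  ([1, 2, 2, 3, 5, 6, 6, 7, 9], [66048, 67184, 67848, 69142, 70022, 103014, 36375, 38040, 34672,
    33408]),
  ([1, 2, 2, 3, 5, 6, 7, 8, 9], [33280, 34352, 35208, 36502, 37190, 70310, 34288, 34240, 33568,
    35436, 35434]),
  ([1, 2, 2, 3, 5, 7, 8, 8, 9], [99808, 132624, 134870, 135462, 132592, 35592, 100906, 100908]),
  ([1, 2, 3, 4, 4, 5, 6, 7, 8], [33280, 35460, 35910, 37018, 37722, 33536, 34416, 34408, 36770,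
    37924]),
  ([1, 2, 3, 4, 4, 5, 6, 7, 9], [590336, 526620, 363140, 233882, 594522, 525056, 266779, 263040,
    428678, 166560, 265574]),
  ([1, 2, 3, 4, 4, 5, 6, 8, 9], [33280, 34424, 35228, 35396, 33408, 37925, 36522, 34272, 36530,
    37595]),
  ([1, 2, 3, 4, 5, 6, 7, 8, 9], [66048, 34272, 34360, 35212, 35396, 36498, 37194, 37546, 35398,
    37515, 34256])]

/-- Certificates excluding codes modulo `21`. -/
def certificates21 : List (List ℕ × List ℕ) := [
  ([1, 1, 2, 3, 4, 5, 8, 8, 10], [131584, 165312, 132656, 102708, 99792, 102692, 164608, 101084,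
    132576]),
  ([1, 1, 2, 3, 4, 6, 8, 8, 9], [98816, 99808, 99888, 67008, 98944, 68316, 99072, 67024, 98880]),
  ([1, 1, 2, 3, 4, 6, 8, 8, 10], [34272, 34352, 35288, 36140, 36548, 37140, 38390, 66432, 38389,
    34112, 36136]),
  ([1, 1, 2, 3, 5, 5, 8, 9, 9], [99776, 132656, 68088, 232008, 167540, 168836, 166476, 36280]),
  ([1, 1, 2, 3, 5, 5, 8, 9, 10], [67008, 67120, 68168, 69940, 68172, 102836, 66304, 70278, 70277]),
  ([1, 1, 2, 3, 5, 6, 6, 8, 10], [197120, 198256, 199064, 167276, 200980, 165312, 165280, 135446,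
    135445, 100208]),
  ([1, 1, 2, 3, 5, 6, 8, 8, 9], [132656, 102100, 66112, 66176, 99896, 66304, 69908, 68652, 69653,
    69654]),
  ([1, 1, 2, 3, 5, 6, 8, 9, 10], [66048, 198112, 35288, 69036, 69204, 69908, 70038, 100760, 70037,
    132560, 34224]),
  ([1, 1, 2, 3, 6, 6, 8, 8, 10], [98816, 167228, 167620, 168196, 100744, 135430, 100680, 67376,
    135429]),
  ([1, 1, 2, 4, 5, 6, 6, 8, 9], [360960, 329336, 264600, 68964, 265876, 103660, 231024, 166172,
    231704]),
  ([1, 1, 2, 4, 5, 6, 8, 8, 10], [66048, 68900, 69332, 102684, 67376, 71150, 67008, 68328, 71149]),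
  ([1, 1, 2, 4, 5, 6, 8, 9, 9], [132664, 100824, 69204, 70572, 68172, 99072, 98944, 103534, 99888,
    103533]),
  ([1, 1, 2, 4, 5, 6, 8, 9, 10], [67040, 35288, 35400, 37548, 38253, 35292, 38254, 33664, 34616,
    37140]),
  ([1, 1, 2, 4, 6, 6, 8, 8, 10], [362040, 233156, 168204, 165688, 231216, 198192, 300542, 300541]),
  ([1, 1, 2, 4, 6, 6, 8, 9, 10], [166344, 134580, 202108, 132560, 199048, 133708, 131840, 132576,
    132656]),
  ([1, 1, 3, 4, 5, 6, 8, 9, 10], [34272, 34360, 35404, 68056, 36433, 36276, 35436, 36434, 33408,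
    37136]),
  ([1, 1, 4, 6, 6, 8, 8, 9, 10], [132636, 199268, 136572, 131840, 165400, 100772, 100804, 132592,
    136573, 132584]),
  ([1, 2, 3, 3, 4, 5, 6, 8, 10], [66048, 68942, 102050, 135474, 36204, 37154, 69923, 37152, 36206]),
  ([1, 2, 3, 3, 4, 5, 8, 9, 10], [66048, 132544, 100956, 69006, 134754, 70290, 69203, 67056, 71002,
    70998]),
  ([1, 2, 3, 4, 5, 6, 8, 9, 10], [33280, 34272, 35292, 35404, 36262, 69202, 37546, 71018, 36624,
    35662, 38254, 35436, 38251, 35288, 37514, 34240])]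

/-- Certificates excluding codes modulo `23`. -/
def certificates23 : List (List ℕ × List ℕ) := [
  ([1, 1, 2, 3, 5, 6, 8, 10, 11], [230880, 132656, 166296, 199240, 201044, 231824, 168598, 168597,
    168404, 167468]),
  ([1, 1, 2, 3, 5, 6, 9, 10, 10], [198112, 99888, 68056, 133704, 132544, 99792, 66176, 99824,
    66304]),
  ([1, 1, 2, 3, 5, 7, 7, 10, 11], [66048, 133528, 68200, 69100, 69148, 70925, 38158, 67440, 66976,
    67008]),
  ([1, 1, 2, 3, 5, 7, 8, 9, 11], [33280, 34272, 34352, 35224, 36140, 37204, 37556, 34240, 34608,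
    36136]),
  ([1, 1, 2, 3, 5, 7, 9, 9, 10], [67040, 67120, 35560, 34240, 34608, 35528, 38086, 38085]),
  ([1, 1, 2, 3, 6, 6, 8, 10, 11], [34352, 35400, 36412, 37188, 35200, 37316, 33536, 37509, 37510]),
  ([1, 1, 2, 4, 4, 7, 8, 9, 10], [66048, 67040, 67992, 68900, 69252, 67008, 133884, 133848, 101664,
    33440]),
  ([1, 1, 2, 4, 4, 7, 8, 10, 10], [1705440, 1379844, 1250236, 819968, 1246768, 754304, 1246760,
    821848, 1117764]),
  ([1, 1, 2, 4, 5, 6, 8, 8, 11], [101668, 102868, 102940, 99072, 67992, 101664, 104173, 104174,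
    67928, 67008]),
  ([1, 1, 2, 4, 5, 6, 8, 9, 11], [1018568, 659796, 726444, 656128, 396232, 661101, 656944, 661102,
    690892]),
  ([1, 1, 2, 4, 5, 6, 8, 10, 10], [787936, 394808, 887192, 657992, 426624, 394736, 426752, 361936,
    525872]),
  ([1, 1, 2, 4, 5, 7, 7, 10, 10], [262656, 132576, 297368, 133736, 197376, 197248, 165488]),
  ([1, 1, 2, 4, 5, 7, 8, 9, 11], [197120, 230880, 231832, 199400, 232740, 71052, 199000, 134868,
    230848, 68060, 198448]),
  ([1, 1, 2, 4, 5, 7, 8, 10, 10], [98816, 99808, 100760, 100968, 103356, 99072, 133704, 71629,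
    98944, 71630, 67024]),
  ([1, 1, 2, 4, 5, 7, 8, 10, 11], [198112, 166296, 134564, 135508, 135868, 100824, 136909, 132784,
    134432, 136910]),
  ([1, 1, 2, 4, 5, 8, 8, 9, 11], [132576, 67096, 68868, 70004, 70300, 101632, 67008, 66976, 67048,
    71277, 71278]),
  ([1, 1, 2, 4, 6, 6, 7, 9, 10], [98816, 165496, 166280, 167604, 71486, 38764, 71485, 34256]),
  ([1, 1, 2, 4, 6, 7, 8, 10, 11], [99824, 198200, 199048, 101812, 102724, 103084, 100152, 133576,
    104158, 104157]),
  ([1, 1, 2, 4, 6, 7, 9, 9, 11], [198128, 132664, 166344, 134868, 135428, 99808, 136669, 134448,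
    136670, 35539]),
  ([1, 1, 3, 3, 5, 7, 8, 9, 10], [35564, 36140, 38016, 33344, 37681, 67056, 34360, 37682, 37200,
    34356]),
  ([1, 1, 3, 3, 5, 7, 8, 9, 11], [164352, 165344, 363820, 266576, 201392, 164736, 66352]),
  ([1, 1, 3, 4, 5, 5, 7, 9, 11], [98816, 67192, 101068, 68932, 69936, 71048, 71050, 66176, 71049]),
  ([1, 1, 3, 4, 5, 6, 7, 9, 10], [557568, 329336, 887500, 396644, 626356, 132432, 297244, 592524,
    165492, 396964]),
  ([1, 1, 3, 4, 5, 6, 7, 9, 11], [393728, 165496, 395676, 200036, 201040, 169386, 297368, 198940,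
    167588, 169385, 393984]),
  ([1, 1, 3, 4, 5, 6, 8, 9, 11], [1245696, 1214008, 1182108, 1870540, 1772836, 1806672, 493320,
    460448, 329192, 364816]),
  ([1, 1, 3, 4, 5, 6, 8, 10, 11], [229888, 231836, 232012, 265636, 233808, 262912, 131712, 98848,
    166360, 231832]),
  ([1, 1, 3, 4, 5, 7, 9, 10, 11], [131584, 132576, 68204, 134564, 134740, 169288, 66352, 67256,
    70032]),
  ([1, 1, 3, 4, 6, 6, 8, 9, 10], [1278464, 1377848, 1903308, 1380020, 886240, 886224, 853552,
    887176, 492288]),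
  ([1, 1, 3, 4, 6, 7, 8, 10, 11], [329272, 658868, 362888, 361936, 329264, 69141, 361216, 394720,
    330316, 197248, 331060]),
  ([1, 1, 3, 4, 6, 7, 9, 9, 11], [360960, 689720, 330476, 429780, 395596, 395660, 265942, 265941,
    395720, 362288]),
  ([1, 1, 3, 5, 6, 7, 9, 10, 11], [164352, 99896, 559564, 200116, 362892, 298580, 526792, 330120,
    332072, 262912, 230880]),
  ([1, 1, 3, 5, 6, 8, 9, 10, 11], [34288, 34328, 35276, 35428, 36244, 37288, 34272, 33536, 35272,
    33408]),
  ([1, 1, 4, 5, 7, 8, 9, 10, 11], [99868, 133580, 100980, 265616, 101960, 102696, 71332, 132892,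
    100844, 101712, 132600]),
  ([1, 1, 4, 6, 7, 8, 9, 10, 11], [1639928, 1574428, 1444292, 1576520, 1052960, 1543568, 1054381,
    1050396, 1477092, 1054382]),
  ([1, 2, 3, 4, 5, 6, 7, 8, 10], [66048, 67192, 67868, 69174, 70490, 71594, 36399, 38062, 34144,
    38843]),
  ([1, 2, 3, 4, 5, 6, 7, 8, 11], [33280, 35100, 36198, 37266, 37466, 38570, 33536, 35224, 36196,
    34240, 38575, 34416]),
  ([1, 2, 3, 4, 5, 6, 7, 9, 10], [1344000, 886240, 1017464, 1116572, 756428, 1117878, 1016448,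
    853620, 951040, 918992, 887502]),
  ([1, 2, 3, 4, 5, 6, 8, 10, 11], [35228, 35404, 36406, 38634, 66304, 36230, 37531, 35224, 34256,
    37210])]

/-- Certificates excluding codes modulo `24`. -/
def certificates24 : List (List ℕ × List ℕ) := [
  ([1, 2, 3, 4, 4, 7, 9, 9, 10], [67040, 68316, 102402, 70906, 71450, 37120, 67120, 67112]),
  ([1, 3, 4, 4, 5, 6, 7, 9, 11], [66048, 68238, 68930, 69282, 37136, 71212])]

/-- Certificates excluding codes modulo `25`. -/
def certificates25 : List (List ℕ × List ℕ) := [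
  ([1, 1, 2, 3, 6, 7, 9, 11, 11], [165344, 198192, 102012, 168868, 132544, 169942, 169941, 101816]),
  ([1, 1, 2, 4, 6, 6, 9, 11, 11], [99888, 166328, 166472, 66176, 198112, 66304, 198096]),
  ([1, 1, 2, 4, 6, 7, 9, 10, 11], [33280, 67120, 35224, 68168, 34256, 36532, 38750, 38749, 33536,
    39071]),
  ([1, 1, 2, 4, 6, 7, 9, 10, 12], [132576, 67120, 133528, 68168, 101672, 135508, 132592, 132544,
    69969, 69970]),
  ([1, 1, 2, 4, 6, 7, 9, 11, 11], [67040, 132656, 100760, 68168, 69236, 70532, 100824, 71645,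
    71646, 70572]),
  ([1, 1, 2, 4, 6, 8, 9, 10, 12], [131584, 99808, 99888, 100968, 102100, 104892, 67376, 101192,
    101676, 99896]),
  ([1, 1, 2, 4, 6, 8, 9, 11, 11], [133736, 134740, 168868, 103340, 137277, 137278, 133704, 101816]),
  ([1, 1, 2, 4, 7, 7, 9, 10, 12], [329264, 166280, 201028, 136572, 136781, 136782, 165688, 231216,
    198200]),
  ([1, 1, 3, 3, 5, 7, 8, 11, 12], [99808, 134636, 99776, 100756, 100760, 99824, 66976, 70352]),
  ([1, 1, 3, 4, 5, 6, 8, 11, 12], [100792, 69068, 36388, 70352, 39272, 36332, 37236, 66304, 68028,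
    35132]),
  ([1, 1, 3, 4, 5, 6, 9, 11, 12], [34240, 68172, 36236, 37364, 34272, 33536, 37236, 37522, 37521,
    36388]),
  ([1, 1, 3, 4, 6, 6, 8, 10, 11], [1114624, 558528, 1050224, 690616, 1182284, 659124, 983680,
    983808]),
  ([1, 1, 3, 4, 6, 7, 8, 10, 12], [34272, 34416, 35404, 69300, 37204, 38184, 66304, 34424, 39385,
    33408, 39386]),
  ([1, 1, 3, 4, 6, 7, 9, 11, 12], [165344, 165424, 199244, 232876, 168405, 164608, 199128, 266580,
    168406, 232892, 164480]),
  ([1, 1, 3, 4, 6, 8, 9, 10, 11], [1836592, 1313176, 1772140, 1346860, 1281748, 856992, 956605,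
    1836600, 560444, 956606]),
  ([1, 1, 3, 5, 6, 9, 9, 11, 12], [165344, 232036, 200068, 133592, 133560, 168586, 131840, 165392,
    167316, 168585]),
  ([1, 1, 3, 5, 7, 8, 9, 11, 12], [886256, 625032, 1150388, 789812, 561832, 361952, 525816, 198456,
    561849, 462428, 561850]),
  ([1, 1, 4, 5, 6, 7, 8, 9, 11], [66048, 67192, 100636, 68292, 68964, 99964, 67996, 67188]),
  ([1, 1, 4, 6, 7, 9, 10, 11, 12], [68044, 35364, 36244, 37288, 34296, 34588, 35380, 37160, 38573,
    38574]),
  ([1, 2, 3, 4, 5, 6, 7, 11, 12], [590336, 99776, 461240, 557824, 492160, 361344, 362940, 493024,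
    231860, 100940]),
  ([1, 2, 3, 4, 5, 6, 8, 11, 12], [66048, 99776, 67184, 68024, 68172, 69158, 135890, 67040, 68020,
    70362, 70355]),
  ([1, 2, 3, 4, 5, 6, 9, 11, 12], [33280, 67008, 35256, 35404, 36236, 37522, 38218, 71402, 33536,
    36238, 34256]),
  ([1, 2, 3, 4, 5, 7, 8, 11, 12], [198256, 100760, 199244, 265708, 200230, 201174, 203082, 197248,
    201466, 202443]),
  ([1, 2, 3, 4, 6, 7, 8, 9, 11], [67040, 99952, 67864, 68300, 69302, 71642, 70466, 71643, 70506,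
    67992, 36220])]

/-- Certificates excluding codes modulo `27`. -/
def certificates27 : List (List ℕ × List ℕ) := [
  ([1, 1, 2, 4, 6, 7, 10, 12, 12], [100760, 166472, 102916, 105437, 105438, 68172, 72700]),
  ([1, 2, 3, 4, 5, 6, 8, 12, 13], [1638912, 1246656, 1378744, 1053094, 987730, 988810, 1120618,
    1344256, 1247664, 760555]),
  ([1, 2, 3, 4, 5, 6, 10, 11, 13], [460224, 430738, 399786, 759130, 494168, 787200, 460256, 429452,
    430452, 432750]),
  ([1, 2, 3, 4, 5, 7, 8, 12, 13], [230880, 362904, 266630, 266834, 235850, 459520, 298532, 298444,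
    231824, 236235]),
  ([1, 2, 3, 4, 5, 8, 10, 11, 12], [66048, 34272, 35420, 36550, 37554, 71562, 34240, 36268, 33536,
    38795, 34256, 35448]),
  ([1, 2, 3, 4, 6, 7, 10, 11, 12], [590336, 362904, 395852, 397654, 463490, 399146, 367451, 296384,
    432346, 364884])]

/-- Certificates excluding codes modulo `29`. -/
def certificates29 : List (List ℕ × List ℕ) := [
  ([1, 1, 2, 5, 6, 9, 9, 12, 13], [33280, 100760, 101728, 70396, 39701, 67184, 39702, 69252, 35368,
    35400]),
  ([1, 1, 3, 4, 6, 8, 10, 12, 14], [262656, 460256, 296496, 67992, 298668, 561492, 460224, 361216,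
    232876, 362896]),
  ([1, 1, 3, 4, 6, 9, 11, 11, 13], [590336, 527660, 334809, 789224, 361920, 334810, 561780, 396584,
    561844, 625356]),
  ([1, 1, 3, 4, 7, 9, 10, 12, 14], [134812, 266580, 201380, 203192, 100936, 102868, 201076,
    131840]),
  ([1, 1, 3, 5, 6, 8, 10, 12, 14], [34272, 35224, 35404, 34352, 33536, 33408, 34240, 34344, 36260,
    35288]),
  ([1, 1, 3, 5, 7, 8, 9, 11, 13], [131584, 133528, 134836, 104216, 99072, 101064, 102052, 102740,
    103020]),
  ([1, 1, 3, 5, 7, 8, 10, 12, 13], [328192, 460344, 362904, 429748, 230960, 165328, 231216, 233204,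
    201052]),
  ([1, 1, 3, 5, 7, 9, 11, 12, 13], [131584, 132576, 132664, 166360, 166508, 200404, 135852, 105280,
    132656, 69524]),
  ([1, 1, 3, 5, 7, 9, 11, 12, 14], [230968, 199128, 166508, 200404, 168212, 164480, 170416, 137794,
    137793, 198128]),
  ([1, 1, 4, 5, 7, 8, 10, 11, 13], [393728, 395980, 396580, 396980, 168272, 169816]),
  ([1, 1, 4, 5, 7, 9, 11, 12, 14], [132576, 68060, 100972, 167204, 134868, 69904, 103752, 66176,
    134580, 105030, 105029]),
  ([1, 1, 4, 6, 8, 9, 11, 12, 14], [68044, 101684, 69332, 70312, 103760, 69044, 73117, 73118,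
    67132, 68452]),
  ([1, 1, 4, 6, 8, 9, 11, 13, 14], [133580, 101812, 69204, 67064, 100808, 100744, 40221, 100748,
    40222]),
  ([1, 2, 3, 4, 5, 7, 11, 12, 13], [1181120, 984624, 1673820, 1937132, 792506, 924490, 983680,
    2034264, 954406, 1053398]),
  ([1, 2, 3, 4, 5, 8, 9, 13, 14], [788080, 985496, 1445356, 924970, 1574336, 1478190, 857818,
    885376, 1021362, 858795]),
  ([1, 2, 3, 4, 5, 8, 10, 11, 14], [66048, 67040, 101676, 36524, 69958, 71258, 72074, 66304,
    68904]),
  ([1, 2, 3, 4, 5, 9, 10, 11, 13], [295424, 361952, 331404, 300890, 268458, 361920, 363816, 334731,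
    267666, 299558]),
  ([1, 2, 3, 4, 5, 9, 10, 12, 13], [198112, 99888, 133756, 134796, 201398, 104410, 170154, 34208,
    67384, 137387]),
  ([1, 2, 3, 4, 6, 7, 10, 12, 14], [295424, 230848, 165424, 199096, 167596, 430742, 230880, 266612,
    230144, 136810]),
  ([1, 2, 3, 4, 6, 8, 9, 13, 14], [263648, 231024, 330136, 234070, 234786, 234914, 230144, 297360,
    263616, 231828, 71299]),
  ([1, 2, 3, 4, 6, 9, 10, 11, 14], [98816, 132576, 99888, 67992, 134444, 69974, 103810, 66304,
    100144, 99776, 68906]),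
  ([1, 2, 3, 4, 7, 8, 9, 10, 14], [33280, 34416, 35096, 36204, 37270, 39258, 34672, 39594, 40363,
    37268, 34240]),
  ([1, 2, 3, 4, 7, 8, 9, 12, 14], [132576, 133528, 135878, 137690, 137770, 138670, 133520, 102740,
    136498, 197376]),
  ([1, 2, 3, 4, 7, 10, 11, 12, 13], [99808, 67088, 68204, 36572, 69942, 70278, 38842, 39754,
    67056]),
  ([1, 2, 3, 4, 8, 9, 10, 12, 14], [132656, 103698, 104874, 105946, 99896, 102110, 101820, 105947,
    102724, 132576]),
  ([1, 2, 3, 5, 6, 7, 10, 11, 14], [197120, 198080, 100792, 133836, 135542, 169578, 105106, 164608,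
    102772, 105171, 133496]),
  ([1, 2, 3, 5, 6, 8, 10, 12, 14], [295424, 132576, 230968, 199244, 199972, 201046, 202026, 333514,
    165424, 199496, 169547])]

/-- Certificates excluding codes modulo `31`. -/
def certificates31 : List (List ℕ × List ℕ) := [
  ([1, 1, 3, 5, 7, 7, 11, 13, 15], [164352, 199096, 133704, 101772, 168308, 70276, 70988, 164608]),
  ([1, 1, 3, 5, 7, 8, 11, 13, 14], [1212928, 1738288, 2165144, 3574344, 3052164, 1020252, 2228992,
    3279436]),
  ([1, 1, 3, 5, 7, 9, 11, 12, 14], [99888, 35224, 101064, 102740, 72562, 72561, 37540, 101100,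
    68904]),
  ([1, 1, 3, 5, 7, 9, 11, 13, 14], [131584, 134804, 70308, 137160, 105328, 105665, 105666, 99072,
    99792, 99896]),
  ([1, 1, 3, 5, 7, 9, 11, 13, 15], [199064, 167340, 201044, 37540, 132592, 133592, 138689, 134440,
    138690]),
  ([1, 1, 3, 5, 8, 9, 11, 13, 15], [133704, 134804, 135492, 71036, 71944, 137512, 102852, 137482,
    137481]),
  ([1, 1, 4, 5, 7, 8, 10, 12, 14], [33280, 68300, 36204, 69300, 37200, 33664, 36516, 67868]),
  ([1, 1, 4, 5, 7, 9, 11, 12, 14], [165344, 232140, 199980, 167572, 168272, 166636, 132664]),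
  ([1, 1, 4, 6, 7, 9, 10, 12, 14], [33280, 34424, 35228, 35532, 36196, 36500, 38312, 35100, 38056]),
  ([1, 1, 4, 6, 7, 9, 11, 13, 15], [33280, 428620, 167332, 364888, 463528, 67992, 400845, 400846,
    462116, 266704]),
  ([1, 1, 4, 6, 8, 10, 11, 13, 15], [69044, 37224, 37544, 38232, 34272, 36148, 36132, 35208, 36260,
    35404]),
  ([1, 1, 5, 7, 9, 10, 12, 13, 15], [68044, 166500, 101812, 169300, 100748, 136528, 68452, 103766,
    100980, 103765]),
  ([1, 2, 3, 4, 6, 8, 11, 13, 15], [263648, 133720, 134828, 168598, 235786, 204282, 135508, 230848,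
    166288, 204347]),
  ([1, 2, 3, 4, 6, 10, 11, 12, 14], [131584, 134444, 104290, 71850, 105306, 101672, 106427, 67008,
    103830, 103092]),
  ([1, 2, 3, 4, 7, 8, 12, 13, 14], [329264, 332422, 268378, 270186, 233748, 297368, 296400, 329152,
    264780, 269083]),
  ([1, 2, 3, 4, 7, 9, 11, 12, 14], [394720, 297368, 396588, 561494, 498762, 427824, 361920, 397990,
    531323, 331484]),
  ([1, 2, 3, 4, 7, 9, 12, 13, 14], [99808, 67120, 68056, 39738, 72842, 66112, 67056, 68204, 69342,
    72507]),
  ([1, 2, 3, 4, 7, 10, 11, 12, 15], [689632, 525872, 724268, 561526, 431558, 399802, 432730,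
    722736, 595334]),
  ([1, 2, 3, 4, 8, 9, 10, 13, 15], [1508976, 1642140, 1873206, 989738, 1252826, 1542528, 1151300,
    1121883, 1016576, 1086150]),
  ([1, 2, 3, 5, 6, 7, 11, 12, 15], [164352, 132544, 133560, 166616, 103902, 138578, 132576, 105075,
    166620, 103062]),
  ([1, 2, 3, 5, 6, 9, 10, 13, 14], [66048, 166296, 101868, 168694, 169278, 169930, 139090, 133752,
    68972, 133724, 169022, 98944]),
  ([1, 2, 3, 5, 8, 9, 10, 12, 15], [98816, 67976, 102036, 104906, 104994, 132728, 38326, 132976,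
    73427, 69956, 67040]),
  ([1, 2, 3, 6, 7, 10, 11, 13, 15], [66048, 67040, 67992, 35432, 36260, 135854, 136526, 137522,
    37244]),
  ([1, 2, 3, 7, 8, 9, 12, 13, 14], [33280, 34360, 35272, 37134, 38802, 38986, 39722, 35208, 40787,
    38811, 37132]),
  ([1, 2, 5, 6, 8, 9, 10, 12, 14], [98816, 99960, 100748, 68300, 102032, 104278, 106458, 99964,
    104214])]

/-- Certificates excluding codes modulo `35`. -/
def certificates35 : List (List ℕ × List ℕ) := [
  ([1, 2, 3, 6, 8, 10, 12, 13, 17], [98816, 99808, 68296, 101668, 70100, 72370, 139898, 73034,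
    67376, 73027, 107135, 102870])]

/-- Certificates excluding codes modulo `37`. -/
def certificates37 : List (List ℕ × List ℕ) := [
  ([1, 1, 4, 6, 8, 10, 12, 15, 17], [66048, 67040, 100940, 134836, 102740, 70952, 66304, 134820]),
  ([1, 1, 4, 6, 8, 11, 13, 15, 17], [98816, 100940, 68908, 102036, 69972, 105328, 70952, 71368,
    100972]),
  ([1, 2, 3, 5, 9, 10, 13, 16, 17], [199064, 199240, 102740, 168580, 236650, 198080, 168612,
    204138, 201350, 198128]),
  ([1, 2, 3, 5, 9, 10, 14, 15, 16], [99808, 165424, 69372, 72554, 106322, 99072, 73555, 98880,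
    99896]),
  ([1, 2, 3, 6, 7, 11, 12, 16, 17], [394720, 395672, 267982, 203682, 131712, 131840, 296384,
    269234, 265708, 67176]),
  ([1, 2, 3, 6, 8, 10, 13, 15, 17], [99808, 67120, 100760, 68168, 37204, 71278, 106242, 69284,
    67008, 73475]),
  ([1, 2, 3, 6, 8, 10, 14, 15, 18], [34272, 35400, 39390, 40354, 42362, 34240, 42363, 33536, 35224,
    38252]),
  ([1, 2, 4, 7, 9, 10, 12, 15, 16], [98816, 67040, 132728, 100760, 100940, 134836, 70698, 104658])]

/-- The certificate tables, indexed by the modulus. -/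
def certificates : List (ℕ × List (List ℕ × List ℕ)) := [
  (5, certificates5),
  (6, certificates6),
  (7, certificates7),
  (8, certificates8),
  (9, certificates9),
  (10, certificates10),
  (11, certificates11),
  (12, certificates12),
  (13, certificates13),
  (14, certificates14),
  (15, certificates15),
  (16, certificates16),
  (17, certificates17),
  (18, certificates18),
  (19, certificates19),
  (20, certificates20),
  (21, certificates21),
  (23, certificates23),
  (24, certificates24),
  (25, certificates25),
  (27, certificates27),
  (29, certificates29),
  (31, certificates31),
  (35, certificates35),
  (37, certificates37)]

/-- One step of the backtracking search: tries each suffix of the list of candidate entries. -/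
def extend (mask : ℕ) (next : List (ℕ × ℕ) → ℕ → List ℕ → Bool) (l : List (ℕ × ℕ)) :
    ℕ → List ℕ → Bool :=
  List.rec (fun _ _ => true) (fun x xs ih s acc =>
    Bool.rec false (ih s acc)
      (Nat.rec (next (x :: xs) (Nat.add s x.2) (x.1 :: acc)) (fun _ _ => true)
        (Nat.land (Nat.add s x.2) mask))) l

/-- Visits the nondecreasing sequences of `r` candidate entries that satisfy Watson's condition, and
checks that each of them passes the test `leaf`. -/
def search (mask : ℕ) (leaf : List ℕ → Bool) (r : ℕ) : List (ℕ × ℕ) → ℕ → List ℕ → Bool :=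
  Nat.rec (fun _ _ acc => leaf acc) (fun _ ih => extend mask ih) r

/-- The packed list of the numbers `d / 2 - lee d (k * v)`, for `0 < k ≤ d / 2`. -/
def deficit (d v : ℕ) : ℕ := pack (fun k => d / 2 - lee d ((k + 1) * v)) (d / 2)

/-- The multiset of the numbers `m - f x`, encoded by its multiplicities as digits in base 16. -/
def key (m : ℕ) (f : ℕ → ℕ) : List ℕ → ℕ
  | [] => 0
  | x :: xs => Nat.add (Nat.pow 16 (m - f x)) (key m f xs)

/-- The largest of `best` and the keys of the multiples of `l` by the elements of a list of units. -/
def maxKey (m : ℕ) (l : List ℕ) : List ℕ → ℕ → ℕ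
  | [], best => best
  | u :: us, best => force (key m (fun x => lee m (Nat.mul u x)) l) fun n =>
      cond (Nat.ble n best) (maxKey m l us best) (maxKey m l us n)

/-- Representatives modulo `d` and up to sign of the units. -/
def unitReps (d : ℕ) : List ℕ :=
  (List.range (d / 2 + 1)).filter fun u => Nat.beq (Nat.gcd u d) 1

/-- Representatives modulo `d` and up to sign of the nonunits. -/
def nonunitReps (d : ℕ) : List ℕ :=
  (List.range (d / 2 + 1)).filter fun u => !Nat.beq (Nat.gcd u d) 1

/-- Membership in a list, in a form that evaluates fast in the kernel. -/
def inList (n : ℕ) : List ℕ → Bool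
  | [] => false
  | x :: xs => cond (Nat.beq n x) true (inList n xs)

/-- The divisors `m` of `d` in a table of certificates, with the units modulo `m` and the keys of the
excluded lists. -/
def levels (d : ℕ) : List (ℕ × List (List ℕ × List ℕ)) →
    (List (ℕ × List ℕ × List ℕ) → Bool) → Bool
  | [], k => k []
  | p :: l, k => cond (Nat.beq (d % p.1) 0)
      (forceMap force id (unitReps p.1) fun us =>
        forceMap force (fun b => key p.1 id b.1) p.2 fun ks =>
          levels d l fun t => k ((p.1, us, ks) :: t))
      (levels d l k)

/-- Whether the reduction of `l` modulo one of the levels is an excluded list. -/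
def kills (l : List ℕ) : List (ℕ × List ℕ × List ℕ) → Bool
  | [] => false
  | e :: t => force (key e.1 (fun x => lee e.1 (Nat.mul 1 x)) l) fun n =>
      force (maxKey e.1 l e.2.1 n) fun n => cond (inList n e.2.2) true (kills l t)

/-- Evaluates both components of a pair before passing it to the continuation. -/
def forcePair {γ : Type} (p : ℕ × ℕ) (k : ℕ × ℕ → γ) : γ :=
  force p.1 fun v => force p.2 fun s => k (v, s)

/-- Whether the search finds that every list that satisfies Watson's condition modulo `d` is excluded
by a certificate. -/
def excludes (d : ℕ) : Bool :=
  force (pack (fun _ => 512) (d / 2)) fun mask =>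
  force (pack (fun _ => 511 - (9 * (d / 2) - 2 * d)) (d / 2)) fun s₀ =>
  force (Nat.add s₀ (deficit d 1)) fun s₁ =>
  levels d certificates fun lv =>
    forceMap forcePair (fun v => (v, deficit d v)) (List.range (d / 2 + 1))
      (fun t => search mask (fun l => kills l lv) 8 t s₁ [1]) &&
    forceMap forcePair (fun v => (v, deficit d v)) (nonunitReps d)
      (fun t => search mask (fun l => kills l lv) 9 t s₀ [])

theorem forcePair_eq {γ : Type} (p : ℕ × ℕ) (k : ℕ × ℕ → γ) : forcePair p k = k p := by
  simp [forcePair, force_eq]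

theorem land_digit_eq_zero {x y a : ℕ} (ha : a ≤ 511) (h : x &&& y = 0) :
    (1024 * x + a) &&& (1024 * y + 512) = 0 := by
  have h1 : ((1024 * x + a) &&& (1024 * y + 512)) % 2 ^ 10 = 0 := by
    rw [Nat.and_mod_two_pow]
    have e1 : (1024 * x + a) % 2 ^ 10 = a := by omega
    have e2 : (1024 * y + 512) % 2 ^ 10 = 2 ^ 9 := by omega
    rw [e1, e2, Nat.and_two_pow, Nat.testBit_lt_two_pow (by omega)]
    simp
  have h2 : ((1024 * x + a) &&& (1024 * y + 512)) / 2 ^ 10 = 0 := by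
    rw [Nat.and_div_two_pow]
    have e1 : (1024 * x + a) / 2 ^ 10 = x := by omega
    have e2 : (1024 * y + 512) / 2 ^ 10 = y := by omega
    rw [e1, e2, h]
  omega

theorem pack_land_eq_zero (f : ℕ → ℕ) (n : ℕ) (h : ∀ k < n, f k ≤ 511) :
    pack f n &&& pack (fun _ => 512) n = 0 := by
  induction n with
  | zero => simp [pack]
  | succ n ih =>
    exact land_digit_eq_zero (h n (by omega)) (ih fun k hk => h k (by omega))

theorem pack_add (f g : ℕ → ℕ) (n : ℕ) :
    pack f n + pack g n = pack (fun k => f k + g k) n := by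
  induction n with
  | zero => rfl
  | succ n ih =>
    simp only [pack, ← ih]
    ring

theorem pack_add_sum_deficit (d : ℕ) (f : ℕ → ℕ) (l : List ℕ) :
    pack f (d / 2) + (l.map (deficit d)).sum =
      pack (fun k => f k + (l.map fun x => d / 2 - lee d ((k + 1) * x)).sum) (d / 2) := by
  induction l generalizing f with
  | nil => simp
  | cons a l ih =>
    simp only [List.map_cons, List.sum_cons, ← add_assoc]
    rw [deficit, pack_add, ih]

theorem ListRealizable.land_eq_zero {d : ℕ} (hd : 0 < d) (hd' : d ≤ 37) {l l' : List ℕ}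
    (h : ListRealizable d l) (hl : l'.Sublist l) :
    (pack (fun _ => 511 - (9 * (d / 2) - 2 * d)) (d / 2) + (l'.map (deficit d)).sum) &&&
      pack (fun _ => 512) (d / 2) = 0 := by
  rw [pack_add_sum_deficit]
  refine pack_land_eq_zero _ _ fun k hk => ?_
  have h1 := h.watson hd (k := k + 1) fun hdvd => by
    have := Nat.le_of_dvd (by omega) hdvd
    omega
  have h2 : (l'.map fun x => d / 2 - lee d ((k + 1) * x)).sum ≤
      (l.map fun x => d / 2 - lee d ((k + 1) * x)).sum :=
    (hl.map _).sum_le_sum fun _ _ => Nat.zero_le _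
  have h3 : ∀ l : List ℕ, (l.map fun x => d / 2 - lee d ((k + 1) * x)).sum +
      (l.map fun x => lee d ((k + 1) * x)).sum = d / 2 * l.length := by
    intro l
    rw [← List.sum_map_add]
    have : ∀ x, d / 2 - lee d ((k + 1) * x) + lee d ((k + 1) * x) = d / 2 := fun x =>
      Nat.sub_add_cancel (lee_le _ _ hd)
    simp only [this, List.map_const', List.sum_replicate, smul_eq_mul]
    exact mul_comm _ _
  have h4 := h3 l
  rw [h.length] at h4
  omega

theorem leaf_of_search {mask : ℕ} {leaf : List ℕ → Bool} (D : ℕ → ℕ) {r : ℕ} {L : List ℕ}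
    {s : ℕ} {acc : List ℕ}
    (h : search mask leaf r (L.map fun v => (v, D v)) s acc = true) (hL : L.Pairwise (· < ·))
    {l : List ℕ} (hlen : l.length = r) (hl : l.Pairwise (· ≤ ·)) (hmem : ∀ x ∈ l, x ∈ L)
    (hm : ∀ l' : List ℕ, l' <+: l → (s + (l'.map D).sum) &&& mask = 0) :
    leaf (l.reverse ++ acc) = true := by
  induction r generalizing L s acc l with
  | zero =>
    obtain rfl := List.length_eq_zero_iff.mp hlen
    exact h
  | succ r ih =>
    induction L with
    | nil =>
      cases l with
      | nil => simp at hlen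
      | cons y l => simpa using hmem y
    | cons x L ihL =>
      obtain ⟨hx, hL'⟩ := List.pairwise_cons.mp hL
      have hstep : search mask leaf (r + 1) ((x :: L).map fun v => (v, D v)) s acc =
          Bool.rec false (search mask leaf (r + 1) (L.map fun v => (v, D v)) s acc)
            (Nat.rec (search mask leaf r ((x :: L).map fun v => (v, D v)) (s + D x) (x :: acc))
              (fun _ _ => true) ((s + D x) &&& mask)) := rfl
      rw [hstep] at h
      cases l with
      | nil => simp at hlen
      | cons y l =>
        obtain ⟨hy, hl'⟩ := List.pairwise_cons.mp hl
        cases hb : (Nat.rec (search mask leaf r ((x :: L).map fun v => (v, D v)) (s + D x)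
            (x :: acc)) (fun _ _ => true) ((s + D x) &&& mask) : Bool) with
        | false => rw [hb] at h; exact absurd h (by simp)
        | true =>
          rw [hb] at h
          by_cases hyx : y = x
          · subst hyx
            have h0 := hm [y] (List.prefix_append [y] l)
            simp only [List.map_cons, List.map_nil, List.sum_singleton] at h0
            rw [h0] at hb
            have := ih hb hL (by simpa using hlen) hl'
              (fun z hz => hmem z (List.mem_cons_of_mem _ hz)) fun l' hl' => by
                have := hm (y :: l') ((List.prefix_cons_inj y).mpr hl')
                rwa [List.map_cons, List.sum_cons, ← add_assoc] at this
            simpa using this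
          · refine ihL h hL' fun z hz => ?_
            rcases List.mem_cons.mp (hmem z hz) with rfl | hz'
            · have hyL : y ∈ L := by
                simpa [hyx] using hmem y List.mem_cons_self
              have := hx y hyL
              rcases List.mem_cons.mp hz with rfl | hz
              · omega
              · have := hy _ hz
                omega
            · exact hz'

theorem levels_eq (d : ℕ) (C : List (ℕ × List (List ℕ × List ℕ)))
    (k : List (ℕ × List ℕ × List ℕ) → Bool) :
    levels d C k = k ((C.filter fun p => Nat.beq (d % p.1) 0).map fun p =>
      (p.1, unitReps p.1, p.2.map fun b => key p.1 id b.1)) := by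
  induction C generalizing k with
  | nil => rfl
  | cons p C ih =>
    simp only [levels, forceMap_eq force_eq, ih, List.filter_cons, List.map_id]
    cases Nat.beq (d % p.1) 0 <;> simp

theorem mem_of_inList {n : ℕ} {l : List ℕ} (h : inList n l = true) : n ∈ l := by
  induction l with
  | nil => simp [inList] at h
  | cons x l ih =>
    rw [inList] at h
    cases hb : Nat.beq n x with
    | true => rw [Nat.eq_of_beq_eq_true hb]; exact List.mem_cons_self
    | false => rw [hb] at h; exact List.mem_cons_of_mem _ (ih h)

theorem exists_maxKey_eq (m : ℕ) (l us : List ℕ) (best : ℕ) :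
    maxKey m l us best = best ∨ ∃ u ∈ us, maxKey m l us best = key m (fun x => lee m (u * x)) l := by
  induction us generalizing best with
  | nil => exact Or.inl rfl
  | cons u us ih =>
    simp only [maxKey, force_eq]
    cases Nat.ble (key m (fun x => lee m (Nat.mul u x)) l) best with
    | true =>
      rcases ih best with h | ⟨v, hv, h⟩
      · exact Or.inl h
      · exact Or.inr ⟨v, List.mem_cons_of_mem _ hv, h⟩
    | false =>
      rcases ih (key m (fun x => lee m (Nat.mul u x)) l) with h | ⟨v, hv, h⟩
      · exact Or.inr ⟨u, List.mem_cons_self, h⟩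
      · exact Or.inr ⟨v, List.mem_cons_of_mem _ hv, h⟩

theorem exists_of_kills {l : List ℕ} {lv : List (ℕ × List ℕ × List ℕ)}
    (h : kills l lv = true) :
    ∃ e ∈ lv, ∃ u ∈ 1 :: e.2.1, key e.1 (fun x => lee e.1 (u * x)) l ∈ e.2.2 := by
  induction lv with
  | nil => simp [kills] at h
  | cons e lv ih =>
    simp only [kills, force_eq] at h
    cases hb : inList (maxKey e.1 l e.2.1 (key e.1 (fun x => lee e.1 (Nat.mul 1 x)) l)) e.2.2 with
    | true =>
      refine ⟨e, List.mem_cons_self, ?_⟩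
      have hmem := mem_of_inList hb
      rcases exists_maxKey_eq e.1 l e.2.1 (key e.1 (fun x => lee e.1 (Nat.mul 1 x)) l) with
        h | ⟨u, hu, h⟩
      · rw [h] at hmem
        exact ⟨1, List.mem_cons_self, hmem⟩
      · rw [h] at hmem
        exact ⟨u, List.mem_cons_of_mem _ hu, hmem⟩
    | false =>
      rw [hb] at h
      obtain ⟨e', he', h'⟩ := ih h
      exact ⟨e', List.mem_cons_of_mem _ he', h'⟩

theorem key_eq (m : ℕ) (f : ℕ → ℕ) (l : List ℕ) :
    key m f l = ((l.map fun x => m - f x).map fun x => 16 ^ x).sum := by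
  induction l with
  | nil => rfl
  | cons x l ih =>
    rw [List.map_cons, List.map_cons, List.sum_cons, ← ih]
    rfl

theorem exists_sum_pow_eq (a : ℕ) (s : List ℕ) :
    ∃ A B n, (s.map fun x => 16 ^ x).sum = A + 16 ^ a * s.count a + 16 ^ a * (16 * B) ∧
      A * 16 ≤ 16 ^ a * n ∧ n + s.count a ≤ s.length := by
  induction s with
  | nil => exact ⟨0, 0, 0, by simp⟩
  | cons x s ih =>
    obtain ⟨A, B, n, h1, h2, h3⟩ := ih
    simp only [List.map_cons, List.sum_cons, List.length_cons, h1]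
    rcases lt_trichotomy x a with h | rfl | h
    · refine ⟨16 ^ x + A, B, n + 1, ?_, ?_, ?_⟩
      · rw [List.count_cons_of_ne h.ne]; ring
      · have : 16 ^ x * 16 ≤ 16 ^ a := by
          rw [← pow_succ]; exact Nat.pow_le_pow_right (by norm_num) h
        linarith
      · rw [List.count_cons_of_ne h.ne]; omega
    · refine ⟨A, B, n, ?_, h2, ?_⟩
      · rw [List.count_cons_self]; ring
      · rw [List.count_cons_self]; omega
    · refine ⟨A, B + 16 ^ (x - a - 1), n, ?_, h2, ?_⟩
      · rw [List.count_cons_of_ne h.ne']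
        have : 16 ^ x = 16 ^ a * (16 * 16 ^ (x - a - 1)) := by
          rw [← pow_succ', ← pow_add]; congr 1; omega
        rw [this]; ring
      · rw [List.count_cons_of_ne h.ne']; omega

theorem count_eq_digit (a : ℕ) (s : List ℕ) (hs : s.length ≤ 15) :
    s.count a = (s.map fun x => 16 ^ x).sum / 16 ^ a % 16 := by
  obtain ⟨A, B, n, h1, h2, h3⟩ := exists_sum_pow_eq a s
  have hp : 0 < 16 ^ a := by positivity
  have hA : A < 16 ^ a := by nlinarith
  rw [h1, add_assoc, ← mul_add, Nat.add_mul_div_left _ _ hp, Nat.div_eq_of_lt hA]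
  omega

theorem perm_of_key_eq {m : ℕ} {f : ℕ → ℕ} {b l : List ℕ} (h : key m id b = key m f l)
    (hb : ∀ x ∈ b, x ≤ m) (hf : ∀ x, f x ≤ m) (hbl : b.length ≤ 15) (hll : l.length ≤ 15) :
    b.Perm (l.map f) := by
  rw [key_eq, key_eq] at h
  have h1 : (b.map fun x => m - x).Perm (l.map fun x => m - f x) := by
    rw [List.perm_iff_count]
    intro a
    rw [count_eq_digit a _ (by simpa), count_eq_digit a _ (by simpa)]
    simp only [id_eq] at h
    rw [h]
  have h2 := h1.map fun x => m - x
  rw [List.map_map, List.map_map] at h2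
  have e1 : b.map ((fun x => m - x) ∘ fun x => m - x) = b := by
    conv_rhs => rw [← List.map_id b]
    refine List.map_congr_left fun x hx => ?_
    have := hb x hx
    simp only [Function.comp_apply, id_eq]
    omega
  have e2 : l.map ((fun x => m - x) ∘ fun x => m - f x) = l.map f := by
    refine List.map_congr_left fun x _ => ?_
    have := hf x
    simp only [Function.comp_apply]
    omega
  rwa [e1, e2] at h2

theorem not_listRealizable_of_kills {d : ℕ} (hd : 0 < d)
    {C : List (ℕ × List (List ℕ × List ℕ))}
    (hC : (C.all fun p => p.2.all fun c => valid p.1 c.1 c.2) = true) {l : List ℕ}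
    (h : kills l ((C.filter fun p => Nat.beq (d % p.1) 0).map fun p =>
      (p.1, unitReps p.1, p.2.map fun b => key p.1 id b.1)) = true) :
    ¬ ListRealizable d l := by
  intro hl
  obtain ⟨e, he, u, hu, hk⟩ := exists_of_kills h
  obtain ⟨p, hp, rfl⟩ := List.mem_map.mp he
  obtain ⟨hpC, hpd⟩ := List.mem_filter.mp hp
  have hdvd : p.1 ∣ d := Nat.dvd_of_mod_eq_zero (Nat.eq_of_beq_eq_true hpd)
  have hm : 0 < p.1 := Nat.pos_of_dvd_of_pos hdvd hd
  obtain ⟨c, hc, hkey⟩ := List.mem_map.mp hk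
  have hv := List.all_eq_true.mp (List.all_eq_true.mp hC p hpC) c hc
  refine not_listRealizable_of_valid hv (hl.of_perm_map hd hdvd (u := u) ?_ ?_)
  · rcases List.mem_cons.mp hu with rfl | hu
    · exact Nat.coprime_one_left _
    · exact Nat.eq_of_beq_eq_true (List.mem_filter.mp hu).2
  · simp only [valid, Bool.and_eq_true, List.all_eq_true] at hv
    refine perm_of_key_eq hkey (fun x hx => Nat.le_of_ble_eq_true (hv.1.1.2 x hx))
      (fun x => (lee_le _ _ hm).trans (Nat.div_le_self _ _)) ?_ ?_
    · rw [Nat.eq_of_beq_eq_true hv.1.1.1]; norm_num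
    · rw [hl.length]; norm_num

theorem gcd_lee (d x : ℕ) (hd : 0 < d) : Nat.gcd (lee d x) d = Nat.gcd x d := by
  have h1 := Nat.mod_lt x hd
  have h2 : Nat.gcd (x % d) d = Nat.gcd x d :=
    ((Nat.gcd_comm x d).trans (Nat.gcd_rec d x)).symm
  rw [← h2]
  rcases le_total (2 * (x % d)) d with h | h
  · rw [show lee d x = x % d by unfold lee; omega]
  · rw [show lee d x = d - x % d by unfold lee; omega, Nat.gcd_self_sub_left h1.le]

theorem ListRealizable.of_perm {d : ℕ} (hd : 2 ≤ d) {l l' : List ℕ} (h : ListRealizable d l)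
    (hl : ∀ x ∈ l, x ≤ d / 2) (hp : l'.Perm l) : ListRealizable d l' := by
  refine h.of_perm_map (by omega) dvd_rfl (Nat.coprime_one_left d) (hp.trans ?_)
  rw [List.map_congr_left (g := id) fun x hx => ?_, List.map_id]
  have := hl x hx
  unfold lee
  rw [one_mul, Nat.mod_eq_of_lt (by omega), id_eq]
  omega

theorem not_listRealizable_of_excludes {d : ℕ} (hd : 2 ≤ d) (hd' : d ≤ 37)
    (hC : (certificates.all fun p => p.2.all fun c => valid p.1 c.1 c.2) = true)
    (h : excludes d = true) (l : List ℕ) : ¬ ListRealizable d l := by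
  have hd0 : 0 < d := by omega
  intro hl
  simp only [excludes, force_eq, levels_eq, forceMap_eq forcePair_eq, Bool.and_eq_true] at h
  obtain ⟨hA, hB⟩ := h
  have hrange : (List.range (d / 2 + 1)).Pairwise (· < ·) := List.pairwise_lt_range
  by_cases hu : ∃ x ∈ l, Nat.Coprime x d
  · obtain ⟨x, hx, hxd⟩ := hu
    obtain ⟨u, -, hu⟩ := Nat.exists_mul_mod_eq_one_of_coprime hxd (by omega)
    have hud : Nat.Coprime u d := by
      have : Nat.Coprime (x * u) d := by
        rw [Nat.Coprime, Nat.gcd_comm, Nat.gcd_rec, hu, Nat.gcd_one_left]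
      exact this.coprime_mul_left
    have hmem : 1 ∈ l.map fun x => lee d (u * x) := by
      refine List.mem_map.mpr ⟨x, hx, ?_⟩
      unfold lee
      rw [mul_comm u, hu]
      omega
    set t := ((l.map fun x => lee d (u * x)).erase 1).mergeSort
    have hperm : (1 :: t).Perm (l.map fun x => lee d (u * x)) :=
      ((List.mergeSort_perm _ _).cons 1).trans (List.perm_cons_erase hmem).symm
    have ht := hl.of_perm_map hd0 dvd_rfl hud hperm
    have hle : ∀ x ∈ 1 :: t, x ≤ d / 2 := fun x hx => by
      obtain ⟨y, -, rfl⟩ := List.mem_map.mp (hperm.subset hx)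
      exact lee_le d _ hd0
    refine not_listRealizable_of_kills hd0 hC
      (leaf_of_search _ hA hrange (l := t) (by simpa using ht.length) ?_ ?_ ?_)
      (ht.of_perm hd hle ?_)
    · exact (List.pairwise_mergeSort' (· ≤ ·) _)
    · intro x hx
      have := hle x (List.mem_cons_of_mem _ hx)
      exact List.mem_range.mpr (by omega)
    · intro t' ht'
      have := ht.land_eq_zero hd0 hd' (ht'.sublist.cons_cons 1)
      rwa [List.map_cons, List.sum_cons, ← add_assoc] at this
    · rw [← List.reverse_cons]
      exact List.reverse_perm _
  · push Not at hu
    set t := (l.map fun x => lee d (1 * x)).mergeSort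
    have hperm : t.Perm (l.map fun x => lee d (1 * x)) := List.mergeSort_perm _ _
    have ht := hl.of_perm_map hd0 dvd_rfl (Nat.coprime_one_left d) hperm
    have hmem : ∀ x ∈ t, ∃ y ∈ l, lee d y = x := fun x hx => by
      simpa using hperm.subset hx
    have hle : ∀ x ∈ t, x ≤ d / 2 := fun x hx => by
      obtain ⟨y, -, rfl⟩ := hmem x hx
      exact lee_le d _ hd0
    refine not_listRealizable_of_kills hd0 hC
      (leaf_of_search _ hB (hrange.filter _) (l := t) ht.length ?_ ?_ ?_)
      (ht.of_perm hd hle ?_)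
    · exact (List.pairwise_mergeSort' (· ≤ ·) _)
    · intro x hx
      refine List.mem_filter.mpr ⟨List.mem_range.mpr (Nat.lt_succ_of_le (hle x hx)), ?_⟩
      obtain ⟨y, hy, rfl⟩ := hmem x hx
      rw [gcd_lee d y hd0]
      cases hb : Nat.beq (Nat.gcd y d) 1 with
      | false => rfl
      | true => exact absurd (Nat.eq_of_beq_eq_true hb) (hu y hy)
    · intro t' ht'
      exact ht.land_eq_zero hd0 hd' ht'.sublist
    · rw [List.append_nil]
      exact List.reverse_perm _

set_option maxRecDepth 10000 in
theorem certificates_valid :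
    (certificates.all fun p => p.2.all fun c => valid p.1 c.1 c.2) = true := by
  decide +kernel

set_option maxRecDepth 10000 in
theorem excludes_of_mem {d : ℕ}
    (h : d ∈ [11, 13, 14, 15, 16, 17, 18, 19, 20, 21, 23, 24, 25, 27, 29, 31, 35, 37]) :
    excludes d = true := by
  revert d
  decide +kernel

theorem Realizable.exists_listRealizable {d : ℕ} (hd : 0 < d) {a : Fin 9 → ℤ}
    (h : Realizable d a) : ∃ l, ListRealizable d l := by
  rw [← one_mul d] at h
  refine ⟨_, fun i => (a i % d).toNat, rfl, h.transfer one_pos 1 isCoprime_one_right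
    (ε := fun _ => 1) (fun _ => one_mul 1) fun i => ?_⟩
  rw [Int.toNat_of_nonneg (Int.emod_nonneg _ (by exact_mod_cast hd.ne'))]
  simp only [one_mul, Equiv.Perm.coe_one, id_eq]
  exact dvd_sub_comm.mp (Int.dvd_self_sub_emod)

theorem exists_dvd_of_notMem {d : ℕ} (hd : 0 < d) (hd' : d ≤ 37)
    (h : d ∉ [1, 2, 3, 4, 5, 6, 7, 8, 9, 10, 12]) :
    ∃ m ∈ [11, 13, 14, 15, 16, 17, 18, 19, 20, 21, 23, 24, 25, 27, 29, 31, 35, 37], m ∣ d := by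
  have key : ∀ n < 38, 0 < n → n ∉ [1, 2, 3, 4, 5, 6, 7, 8, 9, 10, 12] →
      ∃ m ∈ [11, 13, 14, 15, 16, 17, 18, 19, 20, 21, 23, 24, 25, 27, 29, 31, 35, 37], m ∣ n := by
    decide +kernel
  exact key d (Nat.lt_succ_of_le hd') hd h

theorem Realizable.mem {d : ℕ} (hd : 0 < d) (hd' : d ≤ 37) {a : Fin 9 → ℤ}
    (h : Realizable d a) : d ∈ [1, 2, 3, 4, 5, 6, 7, 8, 9, 10, 12] := by
  by_contra hmem
  obtain ⟨m, hm, hmd⟩ := exists_dvd_of_notMem hd hd' hmem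
  obtain ⟨l, hl⟩ := h.exists_listRealizable hd
  have h2 : 2 ≤ m := by
    clear h hl hmd
    revert m
    decide
  exact not_listRealizable_of_excludes h2 ((Nat.le_of_dvd hd hmd).trans hd') certificates_valid
    (excludes_of_mem hm) _ (hl.of_perm_map hd hmd (Nat.coprime_one_left m) (.refl _))

/-- The main inequality in Blichfeldt's packing bound. -/
theorem sum_max_zero_le_one {E : Type*} [NormedAddCommGroup E] [InnerProductSpace ℝ E] {μ : ℝ}
    (hμ : 0 < μ) {ι : Type*} (s : Finset ι) (p : ι → E)
    (hs : ∀ i ∈ s, ∀ j ∈ s, i ≠ j → μ ≤ ‖p i - p j‖ ^ 2) :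
    ∑ i ∈ s, max 0 (1 - 2 / μ * ‖p i‖ ^ 2) ≤ 1 := by
  classical
  set t := s.filter fun i => 0 ≤ 1 - 2 / μ * ‖p i‖ ^ 2
  have h1 : ∑ i ∈ s, max 0 (1 - 2 / μ * ‖p i‖ ^ 2) = ∑ i ∈ t, (1 - 2 / μ * ‖p i‖ ^ 2) := by
    rw [Finset.sum_filter]
    refine Finset.sum_congr rfl fun i _ => ?_
    split_ifs with h
    · exact max_eq_right h
    · exact max_eq_left (not_le.mp h).le
  rw [h1, Finset.sum_sub_distrib, ← Finset.mul_sum]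
  rcases t.eq_empty_or_nonempty with h0 | h0
  · simp [h0]
  have hc : (0 : ℝ) < t.card := by exact_mod_cast h0.card_pos
  have h2 : ∑ i ∈ t, ∑ j ∈ t, ‖p i - p j‖ ^ 2 =
      2 * (t.card * ∑ i ∈ t, ‖p i‖ ^ 2) - 2 * ‖∑ i ∈ t, p i‖ ^ 2 := by
    simp_rw [norm_sub_sq_real, ← real_inner_self_eq_norm_sq (∑ i ∈ t, p i), sum_inner, inner_sum,
      Finset.sum_add_distrib, Finset.sum_sub_distrib, ← Finset.mul_sum, Finset.sum_const,
      nsmul_eq_mul, ← Finset.mul_sum]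
    ring
  have h3 : ∑ i ∈ t, ∑ j ∈ t, (if i = j then 0 else μ) ≤ ∑ i ∈ t, ∑ j ∈ t, ‖p i - p j‖ ^ 2 := by
    refine Finset.sum_le_sum fun i hi => Finset.sum_le_sum fun j hj => ?_
    split_ifs with h
    · positivity
    · exact hs i (Finset.mem_of_mem_filter i hi) j (Finset.mem_of_mem_filter j hj) h
  have h4 : ∑ i ∈ t, ∑ j ∈ t, (if i = j then 0 else μ) = t.card * ((t.card - 1) * μ) := by
    have : ∀ i ∈ t, ∑ j ∈ t, (if i = j then 0 else μ) = (t.card - 1) * μ := fun i hi => by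
      have e : ∀ j, (if i = j then 0 else μ) = μ - if i = j then μ else 0 := by
        intro j; split_ifs <;> simp
      simp_rw [e, Finset.sum_sub_distrib, Finset.sum_ite_eq, if_pos hi, Finset.sum_const,
        nsmul_eq_mul]
      ring
    rw [Finset.sum_congr rfl this, Finset.sum_const, nsmul_eq_mul]
  have h5 : (t.card - 1) * μ ≤ 2 * ∑ i ∈ t, ‖p i‖ ^ 2 := by
    refine le_of_mul_le_mul_left ?_ hc
    have := sq_nonneg ‖∑ i ∈ t, p i‖
    linarith
  have h6 : (t.card - 1 : ℝ) ≤ 2 / μ * ∑ i ∈ t, ‖p i‖ ^ 2 := by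
    rw [div_mul_eq_mul_div, le_div_iff₀ hμ]
    exact h5
  simp only [Finset.sum_const, nsmul_eq_mul, mul_one]
  linarith

open MeasureTheory in
/-- If the translates of `f` by the vectors `x k - v`, for `v` in a lattice, sum to at most `1`, then
the integral of `f` is bounded by the covolume of the lattice. -/
theorem card_mul_lintegral_le {E : Type*} [NormedAddCommGroup E] [NormedSpace ℝ E]
    [FiniteDimensional ℝ E] [MeasurableSpace E] [BorelSpace E] (ν : Measure E)
    [ν.IsAddHaarMeasure] {ι κ : Type*} [Finite ι] (b : Module.Basis ι ℝ E) [Fintype κ] (x : κ → E)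
    {f : E → ENNReal} (hf : Measurable f)
    (h : ∀ y, ∀ s : Finset (κ × Submodule.span ℤ (Set.range b)),
      ∑ i ∈ s, f (y - (x i.1 - i.2)) ≤ 1) :
    Fintype.card κ * ∫⁻ y, f y ∂ν ≤ ν (ZSpan.fundamentalDomain b) := by
  have : VAddInvariantMeasure (Submodule.span ℤ (Set.range b)) E ν :=
    inferInstanceAs (VAddInvariantMeasure (Submodule.span ℤ (Set.range b)).toAddSubgroup E ν)
  have h1 : ∀ k, ∫⁻ y, f y ∂ν =
      ∑' v : Submodule.span ℤ (Set.range b),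
        ∫⁻ y in ZSpan.fundamentalDomain b, f (y - (x k - v)) ∂ν := by
    intro k
    rw [← lintegral_sub_right_eq_self f (x k),
      (ZSpan.isAddFundamentalDomain b ν).lintegral_eq_tsum'']
    refine tsum_congr fun v => lintegral_congr fun y => ?_
    rw [Submodule.vadd_def, vadd_eq_add]
    congr 1
    abel
  calc _ = ∑ k : κ, ∫⁻ y, f y ∂ν := by simp
    _ = ∑' i : κ × Submodule.span ℤ (Set.range b),
        ∫⁻ y in ZSpan.fundamentalDomain b, f (y - (x i.1 - i.2)) ∂ν := by
      rw [ENNReal.tsum_prod', tsum_fintype]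
      exact Finset.sum_congr rfl fun k _ => h1 k
    _ = ∫⁻ y in ZSpan.fundamentalDomain b,
        ∑' i : κ × Submodule.span ℤ (Set.range b), f (y - (x i.1 - i.2)) ∂ν := by
      rw [lintegral_tsum]
      exact fun i => (hf.comp (measurable_id.sub_const _)).aemeasurable
    _ ≤ ∫⁻ y in ZSpan.fundamentalDomain b, 1 ∂ν := by
      refine lintegral_mono fun y => ?_
      rw [ENNReal.tsum_eq_iSup_sum]
      exact iSup_le (h y)
    _ = _ := by simp

open MeasureTheory in
/-- Hadamard's inequality for the volume of a fundamental domain. -/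
theorem volume_fundamentalDomain_le {n : ℕ} [Fact (Module.finrank ℝ (EuclideanSpace ℝ (Fin n)) = n)]
    (b : Module.Basis (Fin n) ℝ (EuclideanSpace ℝ (Fin n))) :
    volume (ZSpan.fundamentalDomain b) ≤ ENNReal.ofReal (∏ i, ‖b i‖) := by
  set b₀ := EuclideanSpace.basisFun (Fin n) ℝ
  rw [ZSpan.measure_fundamentalDomain b volume b₀.toBasis,
    measure_congr (ZSpan.fundamentalDomain_ae_parallelepiped b₀.toBasis volume),
    b₀.coe_toBasis, b₀.volume_parallelepiped, mul_one]
  refine ENNReal.ofReal_le_ofReal ?_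
  rw [← b₀.toBasis.orientation.volumeForm_robust' b₀]
  exact Orientation.abs_volumeForm_apply_le _ _

open MeasureTheory in
theorem integral_Ioi_pow_mul_max {μ : ℝ} (hμ : 0 < μ) :
    ∫ y in Set.Ioi (0 : ℝ), y ^ 8 * max 0 (1 - 2 / μ * y ^ 2) = 2 / 99 * √(μ / 2) ^ 9 := by
  set R := √(μ / 2) with hR
  have hR2 : R ^ 2 = μ / 2 := Real.sq_sqrt (by positivity)
  have hR0 : 0 < R := Real.sqrt_pos.mpr (by positivity)
  have hμR : 2 / μ * R ^ 2 = 1 := by rw [hR2]; field_simp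
  rw [setIntegral_eq_of_subset_of_forall_sdiff_eq_zero measurableSet_Ioi
    (show Set.Ioc 0 R ⊆ _ from Set.Ioc_subset_Ioi_self), setIntegral_congr_fun
    (g := fun y => y ^ 8 - 2 / μ * y ^ 10) measurableSet_Ioc,
    ← intervalIntegral.integral_of_le hR0.le, intervalIntegral.integral_sub,
    intervalIntegral.integral_const_mul, integral_pow, integral_pow]
  · have : R ^ 11 = R ^ 9 * R ^ 2 := by ring
    norm_num
    rw [this]
    linear_combination (-1 / 11 * R ^ 9) * hμR
  · exact (Continuous.intervalIntegrable (by fun_prop) _ _)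
  · exact (Continuous.intervalIntegrable (by fun_prop) _ _)
  · intro y hy
    have h1 : 2 / μ * y ^ 2 ≤ 2 / μ * R ^ 2 := by
      gcongr
      exacts [hy.1.le, hy.2]
    simp only
    rw [max_eq_right (by linarith)]
    ring
  · intro y hy
    have h2 : R < y := by
      by_contra! h
      exact hy.2 ⟨hy.1, h⟩
    have h1 : 2 / μ * R ^ 2 ≤ 2 / μ * y ^ 2 := by gcongr
    rw [max_eq_left (by linarith), mul_zero]

open MeasureTheory in
theorem integral_max_zero {μ : ℝ} (hμ : 0 < μ) :
    ∫ x : EuclideanSpace ℝ (Fin 9), max 0 (1 - 2 / μ * ‖x‖ ^ 2) =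
      64 * Real.pi ^ 4 / 10395 * √(μ / 2) ^ 9 := by
  have hball : volume.real (Metric.ball (0 : EuclideanSpace ℝ (Fin 9)) 1) =
      32 * Real.pi ^ 4 / 945 := by
    have hG : Real.Gamma (9 / 2 + 1) = 945 / 32 * √Real.pi := by
      rw [Real.Gamma_add_one (by norm_num), show (9 / 2 : ℝ) = 7 / 2 + 1 by norm_num,
        Real.Gamma_add_one (by norm_num), show (7 / 2 : ℝ) = 5 / 2 + 1 by norm_num,
        Real.Gamma_add_one (by norm_num), show (5 / 2 : ℝ) = 3 / 2 + 1 by norm_num,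
        Real.Gamma_add_one (by norm_num), show (3 / 2 : ℝ) = 1 / 2 + 1 by norm_num,
        Real.Gamma_add_one (by norm_num), Real.Gamma_one_half_eq]
      ring
    have hp : √Real.pi ^ 2 = Real.pi := Real.sq_sqrt Real.pi_pos.le
    have hp0 : 0 < √Real.pi := Real.sqrt_pos.mpr Real.pi_pos
    rw [Measure.real, EuclideanSpace.volume_ball]
    simp only [Fintype.card_fin, Nat.cast_ofNat, hG, ENNReal.ofReal_one, one_pow, one_mul]
    rw [ENNReal.toReal_ofReal (by positivity)]
    have : √Real.pi ^ 9 = Real.pi ^ 4 * √Real.pi := by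
      calc _ = (√Real.pi ^ 2) ^ 4 * √Real.pi := by ring
        _ = _ := by rw [hp]
    rw [this]
    field_simp
  rw [integral_fun_norm_addHaar volume fun y => max 0 (1 - 2 / μ * y ^ 2), hball,
    finrank_euclideanSpace, Fintype.card_fin]
  simp only [smul_eq_mul, nsmul_eq_mul]
  rw [integral_Ioi_pow_mul_max hμ]
  push_cast
  ring

theorem lt_mul_sqrt_pow {μ : ℝ} (hμ : 0 < μ) :
    √μ ^ 9 < 38 * (64 * Real.pi ^ 4 / 10395 * √(μ / 2) ^ 9) := by
  have h2 : √2 ^ 2 = 2 := Real.sq_sqrt (by norm_num)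
  have h20 : 0 < √2 := by positivity
  have h9 : √2 ^ 9 = 16 * √2 := by
    calc _ = (√2 ^ 2) ^ 4 * √2 := by ring
      _ = _ := by rw [h2]; norm_num
  have hlt : √2 < 1.4143 := by
    rw [Real.sqrt_lt' (by norm_num)]
    norm_num
  have hpi : (3.14 : ℝ) ^ 4 < Real.pi ^ 4 := by
    gcongr
    exact Real.pi_gt_d2
  rw [Real.sqrt_div' μ (by norm_num), div_pow, h9]
  have hs : 0 < √μ ^ 9 := by positivity
  have : 38 * (64 * Real.pi ^ 4 / 10395 * (√μ ^ 9 / (16 * √2))) =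
    (38 * 64 * Real.pi ^ 4 / (10395 * (16 * √2))) * √μ ^ 9 := by
    field_simp
  rw [this]
  refine lt_mul_of_one_lt_left hs ?_
  rw [one_lt_div (by positivity)]
  norm_num at hpi
  linarith

open MeasureTheory in
/-- Blichfeldt's bound on the index of a Minkowskian sublattice in dimension `9`. -/
theorem exists_sub_mem_span {Λ : Submodule ℤ (EuclideanSpace ℝ (Fin 9))} {μ : ℝ} (hμ : 0 < μ)
    (hmin : ∀ x ∈ Λ, x ≠ 0 → μ ≤ ‖x‖ ^ 2) {e : Fin 9 → EuclideanSpace ℝ (Fin 9)}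
    (hli : LinearIndependent ℝ e) (he : ∀ i, e i ∈ Λ) (hnorm : ∀ i, ‖e i‖ ^ 2 = μ)
    (x : Fin 38 → EuclideanSpace ℝ (Fin 9)) (hx : ∀ k, x k ∈ Λ) :
    ∃ k l, k ≠ l ∧ x k - x l ∈ Submodule.span ℤ (Set.range e) := by
  by_contra! hdis
  let b := basisOfLinearIndependentOfCardEqFinrank hli (by simp)
  have hb : ⇑b = e := coe_basisOfLinearIndependentOfCardEqFinrank hli _
  rw [← hb] at hdis
  have hspan : Submodule.span ℤ (Set.range b) ≤ Λ := by
    rw [hb, Submodule.span_le]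
    rintro _ ⟨i, rfl⟩
    exact he i
  have h1 := card_mul_lintegral_le volume b x
    (f := fun y => ENNReal.ofReal (max 0 (1 - 2 / μ * ‖y‖ ^ 2))) (by fun_prop) fun y s => by
      rw [← ENNReal.ofReal_sum_of_nonneg fun _ _ => le_max_left _ _]
      refine ENNReal.ofReal_le_one.mpr (sum_max_zero_le_one hμ s _ ?_)
      rintro ⟨k, v⟩ - ⟨l, w⟩ - hne
      rw [sub_sub_sub_cancel_left]
      refine hmin _ (sub_mem (sub_mem (hx l) (hspan w.2)) (sub_mem (hx k) (hspan v.2)))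
        fun h0 => hne ?_
      have h2 : x k - x l = v - w := by
        rw [sub_eq_zero] at h0
        rw [sub_eq_sub_iff_sub_eq_sub, ← h0]
      have hkl : k = l := by
        by_contra hkl
        exact hdis k l hkl (h2 ▸ sub_mem v.2 w.2)
      subst hkl
      rw [sub_self, eq_comm, sub_eq_zero] at h2
      rw [Subtype.ext h2]
  have : Fact (Module.finrank ℝ (EuclideanSpace ℝ (Fin 9)) = 9) := ⟨by simp⟩
  have h2 := h1.trans (volume_fundamentalDomain_le b)
  have hint : Integrable fun y : EuclideanSpace ℝ (Fin 9) => max 0 (1 - 2 / μ * ‖y‖ ^ 2) := by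
    apply Integrable.of_integral_ne_zero
    rw [integral_max_zero hμ]
    positivity
  have hnorm' : ∀ i, ‖b i‖ = √μ := fun i => by
    rw [hb, ← hnorm i, Real.sqrt_sq (norm_nonneg _)]
  rw [← ofReal_integral_eq_lintegral_ofReal hint (.of_forall fun _ => le_max_left _ _),
    integral_max_zero hμ, Fintype.card_fin, ← ENNReal.ofReal_natCast,
    ← ENNReal.ofReal_mul (by positivity), ENNReal.ofReal_le_ofReal_iff (by positivity)] at h2
  simp only [hnorm', Finset.prod_const, Finset.card_univ, Fintype.card_fin, Nat.cast_ofNat] at h2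
  exact (lt_mul_sqrt_pow hμ).not_ge h2

theorem realizable_of_smul_mem {Λ : Submodule ℤ (EuclideanSpace ℝ (Fin 9))} {μ : ℝ} (hμ : 0 < μ)
    (hmin : ∀ x ∈ Λ, x ≠ 0 → μ ≤ ‖x‖ ^ 2) {e : Fin 9 → EuclideanSpace ℝ (Fin 9)}
    (hli : LinearIndependent ℝ e) (he : ∀ i, e i ∈ Λ) (hnorm : ∀ i, ‖e i‖ ^ 2 = μ)
    {x : EuclideanSpace ℝ (Fin 9)} (hx : x ∈ Λ) {d : ℕ} (hd : 0 < d)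
    (hord : ∀ k : ℤ, k • x ∈ Submodule.span ℤ (Set.range e) ↔ (d : ℤ) ∣ k) :
    ∃ a, Realizable d a := by
  obtain ⟨a, ha⟩ := (Submodule.mem_span_range_iff_exists_fun ℤ).mp ((hord d).mpr dvd_rfl)
  have hdR : (d : ℝ) ≠ 0 := by exact_mod_cast hd.ne'
  have hcancel : ∀ y z : EuclideanSpace ℝ (Fin 9), (d : ℤ) • y = (d : ℤ) • z → y = z := by
    intro y z h
    rw [natCast_zsmul, natCast_zsmul, ← Nat.cast_smul_eq_nsmul ℝ, ← Nat.cast_smul_eq_nsmul ℝ] at h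
    exact smul_right_injective _ hdR h
  refine ⟨a, fun k hk => ?_, fun i j => ⟪e i, e j⟫ / μ, fun i j => ?_, fun i => ?_, ?_⟩
  · choose c hc using hk
    refine (hord k).mp ((Submodule.mem_span_range_iff_exists_fun ℤ).mpr ⟨c, hcancel _ _ ?_⟩)
    rw [smul_comm (d : ℤ) k, ← ha, Finset.smul_sum, Finset.smul_sum]
    exact Finset.sum_congr rfl fun i _ => by rw [smul_smul, smul_smul, hc]
  · simp only [real_inner_comm]
  · simp only
    rw [real_inner_self_eq_norm_sq, hnorm, div_self hμ.ne']
  · rintro v hv ⟨k, hk⟩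
    choose c hc using hk
    set y := k • x + ∑ i, c i • e i
    have hy : y ∈ Λ := add_mem (Λ.smul_mem _ hx) (sum_mem fun i _ => Λ.smul_mem _ (he i))
    have hdy : (d : ℝ) • y = ∑ i, (v i : ℝ) • e i := by
      have : (d : ℤ) • y = ∑ i, v i • e i := by
        rw [smul_add, smul_comm (d : ℤ) k, ← ha, Finset.smul_sum, Finset.smul_sum,
          ← Finset.sum_add_distrib]
        refine Finset.sum_congr rfl fun i _ => ?_
        rw [smul_smul, smul_smul, ← add_smul, ← hc, add_sub_cancel]
      simp only [Int.cast_smul_eq_zsmul]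
      rw [← this, ← Int.cast_smul_eq_zsmul ℝ, Int.cast_natCast]
    have hy0 : y ≠ 0 := by
      intro h0
      rw [h0, smul_zero] at hdy
      have := Fintype.linearIndependent_iff.mp hli _ hdy.symm
      exact hv (funext fun i => by exact_mod_cast this i)
    have h1 : (d : ℝ) ^ 2 * ‖y‖ ^ 2 = ∑ i, ∑ j, (v i : ℝ) * v j * ⟪e i, e j⟫ := by
      calc _ = ⟪(d : ℝ) • y, (d : ℝ) • y⟫ := by
            rw [real_inner_self_eq_norm_sq, norm_smul, mul_pow, Real.norm_eq_abs, sq_abs]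
        _ = _ := by
          rw [hdy]
          simp_rw [sum_inner, inner_sum, inner_smul_left, inner_smul_right]
          simp [mul_assoc]
    simp_rw [← mul_div_assoc, ← Finset.sum_div]
    rw [← h1, le_div_iff₀ hμ]
    gcongr
    exact hmin y hy hy0

theorem latticeMin_le_norm_sq {n : ℕ} {Λ : Submodule ℤ (EuclideanSpace ℝ (Fin n))}
    {x : EuclideanSpace ℝ (Fin n)} (hx : x ∈ Λ) (hx0 : x ≠ 0) : latticeMin Λ ≤ ‖x‖ ^ 2 := by
  rw [← real_inner_self_eq_norm_sq]
  refine csInf_le ⟨0, ?_⟩ ⟨x, hx, hx0, rfl⟩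
  rintro _ ⟨y, -, -, rfl⟩
  exact real_inner_self_nonneg

end Minkowskian

/-- If `Λ` is a lattice in `ℝ⁹` possessing a Minkowskian sublattice `Λ'` with
`Λ/Λ'` cyclic of order `d`, then `d ∈ {1, 2, 3, 4, 5, 6, 7, 8, 9, 10, 12}`. -/
theorem cyclic_quotient_orders_dim_nine
    (Λ Λ' : Submodule ℤ (EuclideanSpace ℝ (Fin 9)))
    (hΛ : IsLattice Λ) (hmink : IsMinkowskian Λ Λ')
    (d : ℕ) (hcyc : Nonempty (quotLat Λ Λ' ≃+ ZMod d)) :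
    d ∈ ({1, 2, 3, 4, 5, 6, 7, 8, 9, 10, 12} : Set ℕ) := by
  obtain ⟨e, hli, he, rfl⟩ := hmink
  obtain ⟨φ⟩ := hcyc
  have hnorm : ∀ i, ‖e i‖ ^ 2 = latticeMin Λ := fun i => by
    rw [← real_inner_self_eq_norm_sq]
    exact (he i).2.2
  have hμ : 0 < latticeMin Λ := by
    rw [← hnorm 0]
    have := norm_pos_iff.mpr (he 0).2.1
    positivity
  have hmin : ∀ x ∈ Λ, x ≠ 0 → latticeMin Λ ≤ ‖x‖ ^ 2 := fun x => Minkowskian.latticeMin_le_norm_sq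
  obtain ⟨x, hx⟩ := Submodule.mkQ_surjective _ (φ.symm 1)
  have hord : ∀ k : ℤ, k • (x : EuclideanSpace ℝ (Fin 9)) ∈ Submodule.span ℤ (Set.range e) ↔
      (d : ℤ) ∣ k := by
    intro k
    calc _ ↔ Submodule.mkQ _ (k • x) = (0 : quotLat Λ (Submodule.span ℤ (Set.range e))) := by
          rw [Submodule.mkQ_apply, Submodule.Quotient.mk_eq_zero]
          rfl
      _ ↔ ((k : ℤ) : ZMod d) = 0 := by
          rw [map_zsmul, hx, ← map_zsmul, EmbeddingLike.map_eq_zero_iff, zsmul_one]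
      _ ↔ _ := ZMod.intCast_zmod_eq_zero_iff_dvd k d
  obtain ⟨k, l, hkl, hmem⟩ := Minkowskian.exists_sub_mem_span hμ hmin hli (fun i => (he i).1) hnorm
    (fun k : Fin 38 => (k : ℤ) • (x : EuclideanSpace ℝ (Fin 9))) fun k => Λ.smul_mem _ x.2
  rw [← sub_smul, hord] at hmem
  have hne : (k : ℤ) - l ≠ 0 := by
    have := Fin.val_ne_of_ne hkl
    omega
  have hd : 0 < d := by
    rcases Nat.eq_zero_or_pos d with rfl | h
    · exact absurd (by simpa using hmem) hne
    · exact h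
  have hd' : d ≤ 37 := by
    have := Int.le_of_dvd (abs_pos.mpr hne) ((dvd_abs _ _).mpr hmem)
    rw [le_abs] at this
    have hk := k.2
    have hl := l.2
    omega
  obtain ⟨a, ha⟩ := Minkowskian.realizable_of_smul_mem hμ hmin hli (fun i => (he i).1) hnorm x.2 hd hord
  simpa using ha.mem hd hd'
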